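/- arXiv:1808.04141 — 2 statements merged into one kernel-verified Lean document; each statement's English description precedes it below -/
import Mathlib

section
/- Let p ∈ ℝ[x] be a nonzero polynomial all of whose zeros lie in the interval [−1, 0] (in particular p is real-rooted). Then D(p) is real-rooted, and moreover D(p) ≺ D((x − α)·p) for every α ∈ [−1, 0]. -/
open Polynomial
open scoped Classical

noncomputable section

/-- The complexification of a real polynomial. -/
def toC (p : ℝ[X]) : ℂ[X] := p.map (algebraMap ℝ ℂ)

/-- A complex polynomial is *stable* if it is identically zero or has no zero with
positive imaginary part. -/
def StableC (f : ℂ[X]) : Prop := f = 0 ∨ ∀ z : ℂ, 0 < z.im → f.eval z ≠ 0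

/-- `Interlaces p q` means `p ≺ q`, i.e. `q + i·p` is stable. -/
def Interlaces (p q : ℝ[X]) : Prop :=
  StableC (toC q + Polynomial.C Complex.I * toC p)

/-- A real polynomial is real-rooted if it is identically zero or all of its complex
zeros are real. -/
def RealRooted (p : ℝ[X]) : Prop :=
  p = 0 ∨ ∀ z : ℂ, (toC p).eval z = 0 → z.im = 0

/-- `Rflip d p = (-1)^d · p(-1-x)`. -/
def Rflip (d : ℕ) (p : ℝ[X]) : ℝ[X] := (-1 : ℝ) ^ d • p.comp (-1 - X)

/-- The f-polynomial of `h` with respect to `d`: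
`f(h;x) = Σ_{k=0}^d h_k x^k (1+x)^{d-k} = (1+x)^d h(x/(1+x))`. -/
def fPoly (d : ℕ) (h : ℝ[X]) : ℝ[X] :=
  ∑ k ∈ Finset.range (d + 1), Polynomial.C (h.coeff k) * X ^ k * (1 + X) ^ (d - k)

/-- The subdivision operator `E`, the unique linear map with `E(binom(x,k)) = x^k`;
here computed via Newton's forward-difference formula
`p = Σ_k (Δ^k p)(0) binom(x,k)` where `Δq = q(x+1) - q(x)`. -/
def subdivE (p : ℝ[X]) : ℝ[X] :=
  ∑ k ∈ Finset.range (p.natDegree + 1),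
    Polynomial.C (((fun q : ℝ[X] => q.comp (X + 1) - q)^[k] p).eval 0) * X ^ k

/-- `Ekd d k = E_k^d = E(x^k (x+1)^(d-k))`. -/
def Ekd (d k : ℕ) : ℝ[X] := subdivE (X ^ k * (X + 1) ^ (d - k))

/-- The cone `𝓔_d` of nonnegative combinations of the `E_k^d`, `0 ≤ k ≤ d`. -/
def coneE (d : ℕ) : Set ℝ[X] :=
  { p | ∃ c : ℕ → ℝ, (∀ i, 0 ≤ c i) ∧ p = ∑ i ∈ Finset.range (d + 1), c i • Ekd d i }

/-- `𝓐_d = {p ∈ 𝓔_d : R_d(p) ≺ p}`. -/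
def Ad (d : ℕ) : Set ℝ[X] := { p | p ∈ coneE d ∧ Interlaces (Rflip d p) p }

/-- `p` is alternatingly increasing with respect to `n`:
`0 ≤ p_0 ≤ p_n ≤ p_1 ≤ p_{n-1} ≤ ⋯ ≤ p_{⌊(n+1)/2⌋}`. -/
def AltInc (n : ℕ) (p : ℝ[X]) : Prop :=
  0 ≤ p.coeff 0 ∧ (∀ k, 2 * k ≤ n → p.coeff k ≤ p.coeff (n - k)) ∧
    (∀ k, 2 * k + 1 ≤ n → p.coeff (n - k) ≤ p.coeff (k + 1))

/-- The number of excedances of an `r`-colored permutation `(σ, z)`: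
indices `k` with `σ k > k`, or `σ k = k` and `z k > 0`. -/
def excC {n r : ℕ} (σ : Equiv.Perm (Fin n)) (z : Fin n → Fin r) : ℕ :=
  (Finset.univ.filter fun k : Fin n => k < σ k ∨ (σ k = k ∧ 0 < (z k : ℕ))).card

/-- The colored Eulerian polynomial `A_{n,r}`. -/
def coloredEulerian (n r : ℕ) : ℝ[X] :=
  ∑ σ : Equiv.Perm (Fin n), ∑ z : Fin n → Fin r, X ^ excC σ z

/-- The colored derangement polynomial `d_{n,r}`: the sum of `x^{exc(σ,z)}` over
colored permutations with no fixed point of color `0`. -/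
def coloredDerangement (n r : ℕ) : ℝ[X] :=
  ∑ σ : Equiv.Perm (Fin n),
    ∑ z ∈ Finset.univ.filter (fun z : Fin n → Fin r => ∀ k, ¬(σ k = k ∧ (z k : ℕ) = 0)),
      X ^ excC σ z

/-- The number of excedances of a permutation. -/
def excP {n : ℕ} (σ : Equiv.Perm (Fin n)) : ℕ :=
  (Finset.univ.filter fun k : Fin n => k < σ k).card

/-- The Eulerian polynomial `A_n`. -/
def eulerianPoly (n : ℕ) : ℝ[X] := ∑ σ : Equiv.Perm (Fin n), X ^ excP σ

/-- The derangement polynomial `d_n`. -/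
def derangePoly (n : ℕ) : ℝ[X] :=
  ∑ σ ∈ Finset.univ.filter (fun σ : Equiv.Perm (Fin n) => ∀ k, σ k ≠ k), X ^ excP σ

/-- The linear map `D` with `D(x^k) = d_k`. -/
def Dmap (p : ℝ[X]) : ℝ[X] :=
  ∑ k ∈ Finset.range (p.natDegree + 1), p.coeff k • derangePoly k

/-- Stability for multivariate complex polynomials: identically zero or nonvanishing
whenever all coordinates have positive imaginary part. -/
def MvStable {n : ℕ} (P : MvPolynomial (Fin n) ℂ) : Prop :=
  P = 0 ∨ ∀ z : Fin n → ℂ, (∀ j, 0 < (z j).im) → MvPolynomial.eval z P ≠ 0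

/-- The operator `T_k(f)(x) = Σ_{i=0}^k (-1)^{k-i} binom(k,i) f((i+1)x)`. -/
def Tk (k : ℕ) (f : ℝ[X]) : ℝ[X] :=
  ∑ i ∈ Finset.range (k + 1),
    ((-1 : ℝ) ^ (k - i) * (k.choose i : ℝ)) • f.comp (Polynomial.C ((i : ℝ) + 1) * X)

/-- The cone `B_{d,γ}` of nonnegative combinations of the polynomials
`x^i (x+1)^{d-i} + x^j (x+1)^{d-j}` with `i + j ≥ γ`. -/
def coneBsum (d γ : ℕ) : Set ℝ[X] :=
  { p | ∃ c : ℕ × ℕ → ℝ, (∀ ij, 0 ≤ c ij) ∧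
      p = ∑ ij ∈ (Finset.range (d + 1) ×ˢ Finset.range (d + 1)).filter
            (fun ij => γ ≤ ij.1 + ij.2),
          c ij • (X ^ ij.1 * (X + 1) ^ (d - ij.1) + X ^ ij.2 * (X + 1) ^ (d - ij.2)) }

/-- The cone `B_{d,m}` of nonnegative combinations of the polynomials
`x^j (mx+1)^{d-j}`, `0 ≤ j ≤ d`. -/
def coneBm (d m : ℕ) : Set ℝ[X] :=
  { p | ∃ c : ℕ → ℝ, (∀ j, 0 ≤ c j) ∧
      p = ∑ j ∈ Finset.range (d + 1), c j • (X ^ j * (Polynomial.C (m : ℝ) * X + 1) ^ (d - j)) }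

end

theorem excP_eq_sum {n : ℕ} (σ : Equiv.Perm (Fin n)) :
    excP σ = ∑ k, if k < σ k then 1 else 0 := by
  unfold excP
  rw [Finset.card_filter]

theorem derangePoly_eq (n : ℕ) : derangePoly n =
    ∑ σ : Equiv.Perm (Fin n), if (∀ k, σ k ≠ k) then (X : ℝ[X]) ^ excP σ else 0 := by
  unfold derangePoly
  rw [Finset.sum_filter]

theorem dec_apply {n : ℕ} (σ : Equiv.Perm (Fin n)) (i k : Fin n) :
    Equiv.Perm.decomposeFin.symm ((σ i).succ, σ) k.succ = if k = i then 0 else (σ k).succ := by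
  rw [Equiv.Perm.decomposeFin_symm_apply_succ]
  split_ifs with h
  · subst h; simp
  · rw [Equiv.swap_apply_of_ne_of_ne]
    · exact Fin.succ_ne_zero _
    · intro h2
      exact h (σ.injective (Fin.succ_injective _ h2))

theorem dec_der {n : ℕ} (σ : Equiv.Perm (Fin n)) (i : Fin n) :
    (∀ k, Equiv.Perm.decomposeFin.symm ((σ i).succ, σ) k ≠ k) ↔ ∀ k, k ≠ i → σ k ≠ k := by
  rw [Fin.forall_fin_succ]
  simp only [dec_apply, Equiv.Perm.decomposeFin_symm_apply_zero]
  constructor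
  · rintro ⟨-, h⟩ k hk h2
    apply h k
    rw [if_neg hk, h2]
  · intro h
    refine ⟨Fin.succ_ne_zero _, fun k => ?_⟩
    split_ifs with hk
    · exact (Fin.succ_ne_zero _).symm
    · intro h2
      exact h k hk (Fin.succ_injective _ h2)

theorem dec_exc {n : ℕ} (σ : Equiv.Perm (Fin n)) (i : Fin n) :
    excP (Equiv.Perm.decomposeFin.symm ((σ i).succ, σ)) =
      excP σ + if i < σ i then 0 else 1 := by
  rw [excP_eq_sum, excP_eq_sum, Fin.sum_univ_succ]
  simp only [dec_apply, Equiv.Perm.decomposeFin_symm_apply_zero]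
  rw [← Finset.add_sum_erase _ _ (Finset.mem_univ i),
    ← Finset.add_sum_erase (Finset.univ) (fun k => if k < σ k then 1 else 0) (Finset.mem_univ i)]
  have : ∑ x ∈ Finset.univ.erase i, (if x.succ < (if x = i then 0 else (σ x).succ) then 1 else 0)
      = ∑ x ∈ Finset.univ.erase i, (if x < σ x then 1 else 0) := by
    apply Finset.sum_congr rfl
    intro x hx
    rw [if_neg (Finset.ne_of_mem_erase hx)]
    simp
  rw [this]
  simp
  split_ifs <;> omega

theorem der_step1 (n : ℕ) : derangePoly (n + 1) =
    ∑ σ : Equiv.Perm (Fin n), ∑ i : Fin n,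
      if (∀ k, k ≠ i → σ k ≠ k) then (X : ℝ[X]) ^ (excP σ + if i < σ i then 0 else 1) else 0 := by
  rw [derangePoly_eq, ← Equiv.sum_comp Equiv.Perm.decomposeFin.symm, Fintype.sum_prod_type,
    Fin.sum_univ_succ]
  have h0 : ∑ σ : Equiv.Perm (Fin n),
      (if (∀ k, Equiv.Perm.decomposeFin.symm ((0 : Fin (n+1)), σ) k ≠ k) then
        (X : ℝ[X]) ^ excP (Equiv.Perm.decomposeFin.symm ((0 : Fin (n+1)), σ)) else 0) = 0 := by
    apply Finset.sum_eq_zero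
    intro σ _
    rw [if_neg]
    intro h
    exact h 0 (by simp)
  rw [h0, zero_add, Finset.sum_comm]
  apply Finset.sum_congr rfl
  intro σ _
  rw [← Equiv.sum_comp σ]
  apply Finset.sum_congr rfl
  intro i _
  simp only [dec_der, dec_exc]

theorem fix_one (m : ℕ) (i : Fin (m + 1)) :
    ∑ σ : Equiv.Perm (Fin (m + 1)),
      (if (σ i = i ∧ ∀ k, k ≠ i → σ k ≠ k) then (X : ℝ[X]) ^ (excP σ) else 0) = derangePoly m := by
  rw [derangePoly_eq, ← Finset.sum_filter, ← Finset.sum_filter]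
  symm
  have key : ∀ (τ : Equiv.Perm (Fin m)) (k : Fin m),
      Equiv.Perm.ofSubtype ((finSuccAboveEquiv i).permCongr τ) (i.succAbove k)
        = i.succAbove (τ k) := by
    intro τ k
    rw [Equiv.Perm.ofSubtype_apply_of_mem (p := fun x => x ≠ i) _ (Fin.succAbove_ne i k)]
    have : (⟨i.succAbove k, Fin.succAbove_ne i k⟩ : {x // x ≠ i}) = finSuccAboveEquiv i k := rfl
    rw [Equiv.permCongr_apply, this]
    simp
    rfl
  have keyi : ∀ (τ : Equiv.Perm (Fin m)),
      Equiv.Perm.ofSubtype ((finSuccAboveEquiv i).permCongr τ) i = i := by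
    intro τ
    exact Equiv.Perm.ofSubtype_apply_of_not_mem _ (by simp)
  refine Finset.sum_bij (fun τ _ => Equiv.Perm.ofSubtype ((finSuccAboveEquiv i).permCongr τ))
    ?_ ?_ ?_ ?_
  · intro τ hτ
    simp only [Finset.mem_filter, Finset.mem_univ, true_and] at hτ ⊢
    refine ⟨keyi τ, fun k hk => ?_⟩
    obtain ⟨j, rfl⟩ := Fin.exists_succAbove_eq hk
    rw [key]
    intro h
    exact hτ j (Fin.succAbove_right_injective h)
  · intro τ _ τ' _ h
    ext k
    have := congrArg (fun f : Equiv.Perm (Fin (m+1)) => f (i.succAbove k)) h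
    simp only [key] at this
    rw [Fin.succAbove_right_injective this]
  · intro σ hσ
    simp only [Finset.mem_filter, Finset.mem_univ, true_and] at hσ
    have hp : ∀ x, σ x ≠ i ↔ x ≠ i := by
      intro x
      rw [not_iff_not]
      constructor
      · intro h; exact σ.injective (h.trans hσ.1.symm)
      · rintro rfl; exact hσ.1
    have hs : ∃ τ : Equiv.Perm (Fin m), ∀ k, i.succAbove (τ k) = σ (i.succAbove k) := by
      refine ⟨(finSuccAboveEquiv i).symm.permCongr (σ.subtypePerm hp), fun k => ?_⟩
      have h1 : ∀ y, i.succAbove y = (finSuccAboveEquiv i y : Fin (m+1)) := fun y => rfl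
      rw [h1, Equiv.permCongr_apply]
      simp
      rfl
    obtain ⟨τ, hτ⟩ := hs
    have he : Equiv.Perm.ofSubtype ((finSuccAboveEquiv i).permCongr τ) = σ := by
      apply Equiv.ext
      intro k
      by_cases hk : k = i
      · subst hk; rw [keyi, hσ.1]
      · obtain ⟨j, rfl⟩ := Fin.exists_succAbove_eq hk
        rw [key, hτ]
    refine ⟨τ, ?_, he⟩
    simp only [Finset.mem_filter, Finset.mem_univ, true_and]
    intro k hk
    apply hσ.2 _ (Fin.succAbove_ne i k)
    rw [← hτ, hk]
  · intro τ _
    congr 1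
    rw [excP_eq_sum, excP_eq_sum, Fin.sum_univ_succAbove _ i]
    rw [keyi]
    simp only [key]
    simp

theorem exc_inner_sum (n : ℕ) (σ : Equiv.Perm (Fin n)) :
    ∑ i : Fin n, (X : ℝ[X]) ^ (excP σ + if i < σ i then 0 else 1) =
      X * (1 - X) * derivative (X ^ excP σ) + (n : ℝ[X]) * (X * X ^ excP σ) := by
  have h1 : ∀ i : Fin n, (X : ℝ[X]) ^ (excP σ + if i < σ i then 0 else 1) =
      X * X ^ excP σ + (if i < σ i then 1 else 0) * ((1 - X) * X ^ excP σ) := by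
    intro i
    split_ifs <;> ring
  simp only [h1]
  rw [Finset.sum_add_distrib, ← Finset.sum_mul (f := fun i : Fin n => if i < σ i then (1 : ℝ[X]) else 0)]
  have h2 : ∑ i : Fin n, (if i < σ i then (1 : ℝ[X]) else 0) = (excP σ : ℝ[X]) := by
    rw [excP_eq_sum]; push_cast; rfl
  rw [h2]
  simp only [Finset.sum_const, Finset.card_univ, Fintype.card_fin, nsmul_eq_mul]
  rcases excP σ with _ | e
  · simp
  · simp only [derivative_X_pow, Nat.add_sub_cancel]
    simp
    ring

theorem der_rec (m : ℕ) : derangePoly (m + 2) =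
    X * (1 - X) * derivative (derangePoly (m + 1)) +
      ((m + 1 : ℕ) : ℝ[X]) * (X * (derangePoly (m + 1) + derangePoly m)) := by
  rw [der_step1]
  have h1 : ∀ (σ : Equiv.Perm (Fin (m+1))) (i : Fin (m+1)),
      (if (∀ k, k ≠ i → σ k ≠ k) then (X : ℝ[X]) ^ (excP σ + if i < σ i then 0 else 1) else 0)
      = (if (∀ k, σ k ≠ k) then (X : ℝ[X]) ^ (excP σ + if i < σ i then 0 else 1) else 0)
        + X * (if (σ i = i ∧ ∀ k, k ≠ i → σ k ≠ k) then (X : ℝ[X]) ^ (excP σ) else 0) := by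
    intro σ i
    by_cases hi : σ i = i
    · have : ¬ ∀ k, σ k ≠ k := fun h => h i hi
      rw [if_neg this]
      simp only [hi, true_and, lt_irrefl, if_false]
      split_ifs <;> ring
    · have : (∀ k, σ k ≠ k) ↔ (∀ k, k ≠ i → σ k ≠ k) := by
        constructor
        · intro h k _; exact h k
        · intro h k
          by_cases hk : k = i
          · subst hk; exact hi
          · exact h k hk
      simp only [hi, false_and, if_false, this]
      ring
  simp only [h1, Finset.sum_add_distrib]
  rw [Finset.sum_comm (f := fun (σ : Equiv.Perm (Fin (m+1))) (i : Fin (m+1)) =>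
    X * (if (σ i = i ∧ ∀ k, k ≠ i → σ k ≠ k) then (X : ℝ[X]) ^ (excP σ) else 0))]
  simp only [← Finset.mul_sum, fix_one]
  have h2 : ∀ σ : Equiv.Perm (Fin (m+1)), ∑ i : Fin (m+1),
      (if (∀ k, σ k ≠ k) then (X : ℝ[X]) ^ (excP σ + if i < σ i then 0 else 1) else 0)
      = X * (1 - X) * derivative (if (∀ k, σ k ≠ k) then (X : ℝ[X]) ^ (excP σ) else 0)
        + ((m + 1 : ℕ) : ℝ[X]) * (X * (if (∀ k, σ k ≠ k) then (X : ℝ[X]) ^ (excP σ) else 0)) := by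
    intro σ
    split_ifs
    · exact exc_inner_sum _ _
    · simp
  simp only [h2, Finset.sum_add_distrib, ← Finset.mul_sum]
  rw [← derivative_sum, ← derangePoly_eq]
  simp
  ring

theorem der_zero : derangePoly 0 = 1 := by
  rw [derangePoly_eq]
  simp [excP]

theorem der_one : derangePoly 1 = 0 := by
  rw [derangePoly_eq]
  apply Finset.sum_eq_zero
  intro σ _
  rw [if_neg]
  intro h
  exact h 0 (Subsingleton.elim _ _)

theorem excP_le {n : ℕ} (σ : Equiv.Perm (Fin n)) : excP σ ≤ n := by
  unfold excP
  exact (Finset.card_le_univ _).trans (by simp)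

theorem der_natDegree (n : ℕ) : (derangePoly n).natDegree ≤ n := by
  unfold derangePoly
  apply natDegree_sum_le_of_forall_le
  intro σ _
  simpa using excP_le σ

theorem der_coeff (n k : ℕ) : 0 ≤ (derangePoly n).coeff k := by
  unfold derangePoly
  rw [finsetSum_coeff]
  apply Finset.sum_nonneg
  intro σ _
  rw [coeff_X_pow]
  split_ifs <;> norm_num

/-- The map `D` as a linear map. -/
noncomputable def DL : ℝ[X] →ₗ[ℝ] ℝ[X] where
  toFun := Dmap
  map_add' p q := by
    have h : ∀ p : ℝ[X], Dmap p = p.sum (fun k a => a • derangePoly k) := by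
      intro p
      unfold Dmap
      rw [Polynomial.sum_over_range]
      intro n; simp
    rw [h, h, h, Polynomial.sum_add_index]
    · intro i; simp
    · intro i a b; rw [add_smul]
  map_smul' c p := by
    have h : ∀ p : ℝ[X], Dmap p = p.sum (fun k a => a • derangePoly k) := by
      intro p
      unfold Dmap
      rw [Polynomial.sum_over_range]
      intro n; simp
    rw [h, h, Polynomial.sum_smul_index]
    · simp only [Polynomial.sum, Finset.smul_sum, mul_smul, RingHom.id_apply]
    · intro i; simp

theorem DL_apply (p : ℝ[X]) : DL p = Dmap p := rfl

theorem DL_X_pow (k : ℕ) : DL (X ^ k) = derangePoly k := by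
  rw [DL_apply, Dmap, Finset.sum_eq_single k]
  · simp
  · intro b _ hb
    rw [coeff_X_pow, if_neg hb, zero_smul]
  · intro h; simp at h

theorem DL_C_mul (c : ℝ) (p : ℝ[X]) : DL (C c * p) = C c * DL p := by
  rw [← smul_eq_C_mul, map_smul, smul_eq_C_mul]

theorem DL_X_mul (p : ℝ[X]) :
    DL (X * p) = X * (1 - X) * derivative (DL p) + X * DL ((1 + X) * derivative p) := by
  induction p using Polynomial.induction_on' with
  | add p q hp hq =>
    simp only [mul_add, map_add, derivative_add] at *
    rw [hp, hq]; ring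
  | monomial n a =>
    rw [← C_mul_X_pow_eq_monomial]
    have h1 : (X : ℝ[X]) * (C a * X ^ n) = C a * X ^ (n + 1) := by ring
    rw [h1, DL_C_mul, DL_C_mul, DL_X_pow, DL_X_pow]
    rcases n with _ | m
    · simp [der_one, der_zero]
    · have h2 : (1 + X) * derivative (C a * X ^ (m + 1)) =
          C a * (C ((m + 1 : ℕ) : ℝ) * (X ^ m + X ^ (m + 1))) := by
        simp only [derivative_C_mul, derivative_X_pow, Nat.add_sub_cancel]
        ring
      rw [h2, DL_C_mul, DL_C_mul, map_add, DL_X_pow, DL_X_pow, der_rec, derivative_C_mul]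
      simp only [map_natCast]
      ring

/-- The product of `X + y` over a multiset. -/
noncomputable def pS (s : Multiset ℝ) : ℝ[X] := (s.map (fun y => X + C y)).prod

theorem pS_cons (y : ℝ) (s : Multiset ℝ) : pS (y ::ₘ s) = (X + C y) * pS s := by
  simp [pS]

theorem pS_der (s : Multiset ℝ) : (1 + X) * derivative (pS s) =
    C (s.card : ℝ) * pS s + (s.map (fun y => C (1 - y) * pS (s.erase y))).sum := by
  unfold pS
  rw [derivative_prod, ← Multiset.sum_map_mul_left]
  have h : C (s.card : ℝ) * (s.map (fun y => X + C y)).prod =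
      (s.map (fun _ => (s.map (fun y : ℝ => X + C y)).prod)).sum := by
    simp
  rw [h, ← Multiset.sum_map_add]
  congr 1
  apply Multiset.map_congr rfl
  intro y hy
  rw [← Multiset.prod_map_erase hy]
  simp
  ring

theorem main_rec (y : ℝ) (s : Multiset ℝ) : DL (pS (y ::ₘ s)) =
    C y * DL (pS s) + (X * (1 - X) * derivative (DL (pS s)) + C (s.card : ℝ) * X * DL (pS s))
     + (s.map (fun a => C (1 - a) * X * DL (pS (s.erase a)))).sum := by
  rw [pS_cons, add_mul, map_add, DL_X_mul, DL_C_mul, pS_der, map_add, DL_C_mul, map_multiset_sum,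
    Multiset.map_map, mul_add, ← Multiset.sum_map_mul_left]
  have : (s.map (fun i => X * (DL ∘ fun y => C (1 - y) * pS (s.erase y)) i)) =
    (s.map (fun a => C (1 - a) * X * DL (pS (s.erase a)))) := by
    apply Multiset.map_congr rfl
    intro a _
    simp only [Function.comp, DL_C_mul]
    ring
  rw [this]
  ring

theorem pS_coeff (s : Multiset ℝ) (hs : ∀ y ∈ s, 0 ≤ y) (k : ℕ) : 0 ≤ (pS s).coeff k := by
  induction s using Multiset.induction_on generalizing k with
  | empty => simp [pS, coeff_one]; split_ifs <;> norm_num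
  | cons y s ih =>
    have ih' := ih (fun a ha => hs a (Multiset.mem_cons_of_mem ha))
    have hy := hs y (Multiset.mem_cons_self _ _)
    rw [pS_cons, add_mul, coeff_add, coeff_C_mul]
    have h2 := mul_nonneg hy (ih' k)
    rcases k with _ | k
    · simpa using h2
    · rw [coeff_X_mul]
      exact add_nonneg (ih' k) h2

theorem pS_natDegree (s : Multiset ℝ) : (pS s).natDegree = s.card := by
  unfold pS
  rw [natDegree_multiset_prod_of_monic]
  · simp
  · intro f hf
    obtain ⟨y, _, rfl⟩ := Multiset.mem_map.1 hf
    exact monic_X_add_C y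

theorem R_natDegree (s : Multiset ℝ) : (DL (pS s)).natDegree ≤ s.card := by
  rw [DL_apply, Dmap]
  apply natDegree_sum_le_of_forall_le
  intro k hk
  rw [pS_natDegree, Finset.mem_range] at hk
  exact (natDegree_smul_le _ _).trans ((der_natDegree k).trans (by omega))

theorem R_coeff (s : Multiset ℝ) (hs : ∀ y ∈ s, 0 ≤ y) (k : ℕ) : 0 ≤ (DL (pS s)).coeff k := by
  rw [DL_apply, Dmap, finsetSum_coeff]
  apply Finset.sum_nonneg
  intro i _
  rw [coeff_smul, smul_eq_mul]
  exact mul_nonneg (pS_coeff s hs i) (der_coeff _ _)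

theorem eval_pos_of_coeff (P : ℝ[X]) (hP : P ≠ 0) (hc : ∀ k, 0 ≤ P.coeff k) (x : ℝ) (hx : 0 < x) :
    0 < P.eval x := by
  rw [eval_eq_sum, Polynomial.sum]
  apply Finset.sum_pos
  · intro i hi
    have h1 := (hc i).lt_of_ne (mem_support_iff.1 hi).symm
    positivity
  · exact nonempty_support_iff.2 hP

/-- The convex cone spanned by `1` and `z`. -/
def InK (z w : ℂ) : Prop := ∃ a b : ℝ, 0 ≤ a ∧ 0 ≤ b ∧ w = a + b * z

theorem InK.zero (z : ℂ) : InK z 0 := ⟨0, 0, le_rfl, le_rfl, by simp⟩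

theorem InK.add {z w w' : ℂ} (h : InK z w) (h' : InK z w') : InK z (w + w') := by
  obtain ⟨a, b, ha, hb, rfl⟩ := h
  obtain ⟨a', b', ha', hb', rfl⟩ := h'
  exact ⟨a + a', b + b', by positivity, by positivity, by push_cast; ring⟩

theorem InK.smul {z w : ℂ} (h : InK z w) {c : ℝ} (hc : 0 ≤ c) : InK z (c * w) := by
  obtain ⟨a, b, ha, hb, rfl⟩ := h
  exact ⟨c * a, c * b, by positivity, by positivity, by push_cast; ring⟩

theorem InK.div {z w : ℂ} (h : InK z w) : InK z (z / w) := by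
  by_cases hw : w = 0
  · subst hw; simpa using InK.zero z
  obtain ⟨a, b, ha, hb, rfl⟩ := h
  have hN : 0 < Complex.normSq (a + b * z) := Complex.normSq_pos.2 hw
  refine ⟨b * Complex.normSq z / Complex.normSq (a + b * z), a / Complex.normSq (a + b * z),
    div_nonneg (mul_nonneg hb (Complex.normSq_nonneg _)) hN.le, by positivity, ?_⟩
  rw [div_eq_mul_inv, Complex.inv_def]
  push_cast
  rw [← Complex.mul_conj z]
  simp only [map_add, map_mul, Complex.conj_ofReal]
  field_simp
  ring

theorem InK.im_nonneg {z w : ℂ} (hz : 0 < z.im) (h : InK z w) : 0 ≤ w.im := by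
  obtain ⟨a, b, ha, hb, rfl⟩ := h
  simp
  positivity

theorem InK.add_eq_zero {z w w' : ℂ} (hz : 0 < z.im) (h : InK z w) (h' : InK z w')
    (h0 : w + w' = 0) : w = 0 ∧ w' = 0 := by
  obtain ⟨a, b, ha, hb, rfl⟩ := h
  obtain ⟨a', b', ha', hb', rfl⟩ := h'
  have him := congrArg Complex.im h0
  have hre := congrArg Complex.re h0
  simp at him hre
  have h1 : (b + b') * z.im = 0 := by linarith
  have h2 : b + b' = 0 := by
    rcases mul_eq_zero.1 h1 with h | h
    · exact h
    · exact absurd h hz.ne'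
  have hb0 : b = 0 := by linarith
  have hb0' : b' = 0 := by linarith
  subst hb0; subst hb0'
  simp at hre
  have ha0 : a = 0 := by linarith
  have ha0' : a' = 0 := by linarith
  subst ha0; subst ha0'
  simp

theorem InK.multiset_sum {z : ℂ} (m : Multiset ℂ) (h : ∀ w ∈ m, InK z w) : InK z m.sum := by
  induction m using Multiset.induction_on with
  | empty => simpa using InK.zero z
  | cons a m ih =>
    rw [Multiset.sum_cons]
    exact (h a (Multiset.mem_cons_self _ _)).add
      (ih (fun w hw => h w (Multiset.mem_cons_of_mem hw)))

theorem InK.multiset_sum_ne {z : ℂ} (hz : 0 < z.im) (m : Multiset ℂ) (h : ∀ w ∈ m, InK z w)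
    (h0 : ∀ w ∈ m, w ≠ 0) (hm : m ≠ 0) : m.sum ≠ 0 := by
  obtain ⟨a, ha⟩ := Multiset.exists_mem_of_ne_zero hm
  obtain ⟨t, rfl⟩ := Multiset.exists_cons_of_mem ha
  rw [Multiset.sum_cons]
  intro h1
  have := InK.add_eq_zero hz (h a ha)
    (InK.multiset_sum t (fun w hw => h w (Multiset.mem_cons_of_mem hw))) h1
  exact h0 a ha this.1

/-- A real polynomial without zeros in the open upper half plane is real-rooted. -/
theorem real_of_upper (P : ℝ[X]) (h : ∀ z : ℂ, 0 < z.im → aeval z P ≠ 0) (z : ℂ)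
    (hz : aeval z P = 0) : z.im = 0 := by
  rcases lt_trichotomy z.im 0 with h1 | h1 | h1
  · exfalso
    apply h ((starRingEnd ℂ) z) (by simpa using h1)
    rw [aeval_conj, hz, map_zero]
  · exact h1
  · exact absurd hz (h z h1)

/-- The key cone estimate for the logarithmic-derivative part. -/
theorem logder (P : ℝ[X]) (n : ℕ) (hn : P.natDegree ≤ n) (hn1 : 1 ≤ n) (hc : ∀ k, 0 ≤ P.coeff k)
    (h : ∀ z : ℂ, 0 < z.im → aeval z P ≠ 0) (z : ℂ) (hz : 0 < z.im) :
    InK z (z * (1 - z) * (aeval z (derivative P) / aeval z P) + n * z) ∧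
      z * (1 - z) * (aeval z (derivative P) / aeval z P) + n * z ≠ 0 := by
  have hz0 : z ≠ 0 := by rintro rfl; simp at hz
  have hP0 : P ≠ 0 := by rintro rfl; exact h z hz (by simp)
  set Q : ℂ[X] := P.map (algebraMap ℝ ℂ) with hQ
  have hev : ∀ w : ℂ, aeval w P = Q.eval w := fun w => by rw [hQ, eval_map_algebraMap]
  have hdev : aeval z (derivative P) = (derivative Q).eval z := by
    rw [hQ, derivative_map, eval_map_algebraMap]
  have hQz : Q.eval z ≠ 0 := by rw [← hev]; exact h z hz
  have hQ0 : Q ≠ 0 := by intro h0; rw [h0] at hQz; simp at hQz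
  have hsp : Q.Splits := IsAlgClosed.splits Q
  rw [hdev, hev, hsp.eval_derivative_div_eval_of_ne_zero hQz]
  have hroot : ∀ r ∈ Q.roots, ∃ t : ℝ, 0 ≤ t ∧ r = -(t : ℂ) := by
    intro r hr
    have hr0 : aeval r P = 0 := by rw [hev]; exact (mem_roots hQ0).1 hr
    have him := real_of_upper P h r hr0
    have hre : r = (r.re : ℂ) := Complex.ext (by simp) (by simp [him])
    refine ⟨-r.re, ?_, by rw [hre]; simp⟩
    by_contra hneg
    push Not at hneg
    have hp := eval_pos_of_coeff P hP0 hc r.re (by linarith)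
    rw [hre, ← Complex.coe_algebraMap, aeval_algebraMap_apply] at hr0
    simp at hr0
    exact hp.ne' hr0
  have hcard : Q.roots.card ≤ n := by
    refine (card_roots' Q).trans ?_
    rw [hQ, natDegree_map]; exact hn
  have hsum : z * (1 - z) * (Q.roots.map fun r => 1 / (z - r)).sum + n * z =
      (Q.roots.map fun r => z * ((1 - r) / (z - r))).sum + ((n - Q.roots.card : ℕ) : ℝ) * z := by
    have h1 : (Q.roots.map fun r => z * ((1 - r) / (z - r))).sum =
        z * (1 - z) * (Q.roots.map fun r => 1 / (z - r)).sum + Q.roots.card * z := by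
      have h2 : (Q.roots.card : ℂ) * z = (Q.roots.map fun _ => z).sum := by simp
      rw [h2, ← Multiset.sum_map_mul_left, ← Multiset.sum_map_add]
      congr 1
      apply Multiset.map_congr rfl
      intro r hr
      have : z - r ≠ 0 := by
        intro h0
        have : z = r := sub_eq_zero.1 h0
        rw [← this] at hr
        exact hQz ((mem_roots hQ0).1 hr)
      field_simp
      ring
    rw [h1]
    push_cast [Nat.cast_sub hcard]
    ring
  rw [hsum]
  have hK1 : ∀ w ∈ Q.roots.map (fun r => z * ((1 - r) / (z - r))), InK z w ∧ w ≠ 0 := by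
    intro w hw
    obtain ⟨r, hr, rfl⟩ := Multiset.mem_map.1 hw
    obtain ⟨t, ht, rfl⟩ := hroot r hr
    have hden : z + t ≠ 0 := by
      intro h0
      have := congrArg Complex.im h0
      simp at this
      exact hz.ne' this
    constructor
    · have h1 : InK z (t + z) := ⟨t, 1, ht, zero_le_one, by simp⟩
      have h2 := h1.div.smul (c := 1 + t) (by positivity)
      convert h2 using 1
      rw [sub_neg_eq_add, sub_neg_eq_add, add_comm (t : ℂ) z]
      push_cast
      ring
    · rw [sub_neg_eq_add, sub_neg_eq_add]
      refine mul_ne_zero hz0 (div_ne_zero ?_ hden)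
      exact_mod_cast (by positivity : (1 + t : ℝ) ≠ 0)
  have hzK : InK z z := ⟨0, 1, le_rfl, zero_le_one, by simp⟩
  have hA := InK.multiset_sum _ (fun w hw => (hK1 w hw).1)
  have hB := hzK.smul (c := ((n - Q.roots.card : ℕ) : ℝ)) (Nat.cast_nonneg _)
  refine ⟨hA.add hB, fun h0 => ?_⟩
  obtain ⟨e1, e2⟩ := InK.add_eq_zero hz hA hB h0
  have hr0 : Q.roots = 0 := by
    by_contra hne
    exact InK.multiset_sum_ne hz _ (fun w hw => (hK1 w hw).1) (fun w hw => (hK1 w hw).2)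
      (by simpa using hne) e1
  rw [hr0] at e2
  simp at e2
  rcases e2 with e2 | e2
  · omega
  · exact hz0 e2

theorem R_zero : DL (pS 0) = 1 := by
  have : pS 0 = X ^ 0 := by simp [pS]
  rw [this, DL_X_pow, der_zero]

theorem R_one (a : ℝ) : DL (pS {a}) = C a := by
  have := main_rec a 0
  rw [R_zero] at this
  simpa using this

theorem R_two (y a : ℝ) : DL (pS (y ::ₘ {a})) = C (y * a) + X := by
  rw [main_rec, R_one]
  simp [R_zero]
  ring

theorem main_ind (n : ℕ) : ∀ s : Multiset ℝ, s.card = n → (∀ a ∈ s, 0 ≤ a ∧ a ≤ 1) →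
    ∀ y : ℝ, 0 ≤ y → y ≤ 1 → ∀ z : ℂ, 0 < z.im →
      InK z (aeval z (DL (pS (y ::ₘ s))) / aeval z (DL (pS s))) ∧
      (1 ≤ n → aeval z (DL (pS (y ::ₘ s))) ≠ 0) := by
  induction n with
  | zero =>
    intro s hs _ y hy _ z hz
    rw [Multiset.card_eq_zero] at hs
    subst hs
    refine ⟨⟨y, 0, hy, le_rfl, ?_⟩, by omega⟩
    have : y ::ₘ (0 : Multiset ℝ) = {y} := rfl
    rw [this, R_zero, R_one]
    simp
  | succ n ih =>
    intro s hs hsI y hy hy1 z hz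
    have hmain : (∀ z : ℂ, 0 < z.im → aeval z (DL (pS s)) ≠ 0) →
        InK z (aeval z (DL (pS (y ::ₘ s))) / aeval z (DL (pS s))) ∧
      (1 ≤ n + 1 → aeval z (DL (pS (y ::ₘ s))) ≠ 0) := by
      intro hnz
      obtain ⟨hL, hL0⟩ := logder (DL (pS s)) (n + 1) (hs ▸ R_natDegree s) (by omega)
        (R_coeff s (fun a ha => (hsI a ha).1)) hnz z hz
      have hP := hnz z hz
      have hT : InK z ((s.map (fun a => ((1 - a : ℝ) : ℂ) *
          (z / (aeval z (DL (pS s)) / aeval z (DL (pS (s.erase a))))))).sum) := by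
        apply InK.multiset_sum
        intro w hw
        obtain ⟨a, ha, rfl⟩ := Multiset.mem_map.1 hw
        refine InK.smul (InK.div ?_) (by linarith [(hsI a ha).2])
        have := (ih (s.erase a) (by rw [Multiset.card_erase_of_mem ha, hs]; rfl)
          (fun b hb => hsI b (Multiset.mem_of_mem_erase hb)) a (hsI a ha).1 (hsI a ha).2 z hz).1
        rwa [Multiset.cons_erase ha] at this
      have hY : InK z (y : ℂ) := ⟨y, 0, hy, le_rfl, by simp⟩
      have heq : aeval z (DL (pS (y ::ₘ s))) / aeval z (DL (pS s)) =
          (y + (s.map (fun a => ((1 - a : ℝ) : ℂ) *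
          (z / (aeval z (DL (pS s)) / aeval z (DL (pS (s.erase a))))))).sum) +
          (z * (1 - z) * (aeval z (derivative (DL (pS s))) / aeval z (DL (pS s)))
            + ((n + 1 : ℕ) : ℂ) * z) := by
        have hTe : (s.map (fun a => ((1 - a : ℝ) : ℂ) *
          (z / (aeval z (DL (pS s)) / aeval z (DL (pS (s.erase a))))))).sum =
            (s.map (fun a => aeval z (C (1 - a) * X * DL (pS (s.erase a))))).sum
              / aeval z (DL (pS s)) := by
          rw [div_eq_mul_inv, ← Multiset.sum_map_mul_right]
          congr 1
          apply Multiset.map_congr rfl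
          intro a _
          rw [map_mul, map_mul, aeval_C, aeval_X, div_div_eq_mul_div, Complex.coe_algebraMap]
          ring
        rw [hTe, main_rec, map_add, map_add, map_multiset_sum, Multiset.map_map, hs]
        simp only [map_add, map_mul, aeval_C, aeval_X, map_sub, map_one, Complex.coe_algebraMap,
          Function.comp_def]
        push_cast
        field_simp
        ring
      rw [heq]
      refine ⟨(hY.add hT).add hL, fun _ h0 => ?_⟩
      rw [h0, zero_div] at heq
      exact hL0 (InK.add_eq_zero hz (hY.add hT) hL heq.symm).2
    rcases n with _ | n
    · obtain ⟨a, rfl⟩ := Multiset.card_eq_one.1 hs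
      by_cases ha : a = 0
      · subst ha
        rw [R_two, R_one]
        refine ⟨by simpa using InK.zero z, fun _ => ?_⟩
        simp
        rintro rfl
        simp at hz
      · apply hmain
        intro z _
        rw [R_one]
        simpa using ha
    · apply hmain
      intro z hz
      have hne : s ≠ 0 := by rintro rfl; simp at hs
      obtain ⟨b, hb⟩ := Multiset.exists_mem_of_ne_zero hne
      have := (ih (s.erase b) (by rw [Multiset.card_erase_of_mem hb, hs]; rfl)
          (fun c hc => hsI c (Multiset.mem_of_mem_erase hc)) b (hsI b hb).1 (hsI b hb).2 z hz).2
            (by omega)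
      rwa [Multiset.cons_erase hb] at this

theorem R_nz (s : Multiset ℝ) (hs : ∀ a ∈ s, 0 ≤ a ∧ a ≤ 1) :
    s = {0} ∨ ∀ z : ℂ, 0 < z.im → aeval z (DL (pS s)) ≠ 0 := by
  by_cases h0 : s = 0
  · right; subst h0; intro z _; rw [R_zero]; simp
  obtain ⟨b, hb⟩ := Multiset.exists_mem_of_ne_zero h0
  by_cases h1 : s.card = 1
  · obtain ⟨a, rfl⟩ := Multiset.card_eq_one.1 h1
    by_cases ha : a = 0
    · left; rw [ha]
    · right; intro z _; rw [R_one]; simpa using ha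
  · right
    intro z hz
    have hc : s.card ≠ 0 := by simpa using h0
    have := (main_ind (s.card - 1) (s.erase b) (by rw [Multiset.card_erase_of_mem hb]; rfl)
          (fun c hc => hs c (Multiset.mem_of_mem_erase hc)) b (hs b hb).1 (hs b hb).2 z hz).2
            (by omega)
    rwa [Multiset.cons_erase hb] at this

theorem exists_pS (p : ℝ[X]) (hp : p ≠ 0)
    (hroots : ∀ z : ℂ, (toC p).eval z = 0 → z.im = 0 ∧ -1 ≤ z.re ∧ z.re ≤ 0) :
    ∃ (c : ℝ) (s : Multiset ℝ), c ≠ 0 ∧ (∀ a ∈ s, 0 ≤ a ∧ a ≤ 1) ∧ p = C c * pS s := by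
  have hsp : p.Splits := by
    refine (IsAlgClosed.splits (p.map (algebraMap ℝ ℂ))).of_splits_map _ ?_
    intro a ha
    have h := hroots a ((mem_roots'.1 ha).2)
    exact ⟨a.re, Complex.ext (by simp) (by simp [h.1])⟩
  refine ⟨p.leadingCoeff, p.roots.map (fun r => -r), leadingCoeff_ne_zero.2 hp, ?_, ?_⟩
  · intro a ha
    obtain ⟨r, hr, rfl⟩ := Multiset.mem_map.1 ha
    have := hroots (r : ℂ) (by
      rw [toC, eval_map_algebraMap, ← Complex.coe_algebraMap, aeval_algebraMap_apply]
      have : p.eval r = 0 := (mem_roots'.1 hr).2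
      simp [this])
    simp at this
    constructor <;> linarith [this.1, this.2]
  · conv_lhs => rw [hsp.eq_prod_roots]
    simp [pS, Multiset.map_map, sub_eq_add_neg]


/-- if `p` is a nonzero real polynomial all of whose zeros lie in
`[-1, 0]`, then `D(p)` is real-rooted and `D(p) ≺ D((x - α)·p)` for every
`α ∈ [-1, 0]`. -/
theorem stmt13 (p : ℝ[X]) (hp : p ≠ 0)
    (hroots : ∀ z : ℂ, (toC p).eval z = 0 → z.im = 0 ∧ -1 ≤ z.re ∧ z.re ≤ 0) :
    RealRooted (Dmap p) ∧
    ∀ α : ℝ, -1 ≤ α → α ≤ 0 →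
      Interlaces (Dmap p) (Dmap ((X - Polynomial.C α) * p)) := by
  obtain ⟨c, s, hc, hs, rfl⟩ := exists_pS p hp hroots
  have hcC : (c : ℂ) ≠ 0 := by exact_mod_cast hc
  rcases R_nz s hs with rfl | hnz
  · refine ⟨Or.inl ?_, fun α h1 h2 => Or.inr ?_⟩
    · rw [← DL_apply, DL_C_mul, R_one]; simp
    · intro z hz
      have e : (X - C α) * (C c * pS {0}) = C c * pS ((-α) ::ₘ {0}) := by
        rw [pS_cons]; simp; ring
      rw [e, ← DL_apply, ← DL_apply, DL_C_mul, DL_C_mul, R_one, R_two]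
      have hz0 : z ≠ 0 := by rintro rfl; simp at hz
      simp [toC, hcC, hz0]
  · refine ⟨Or.inr ?_, fun α h1 h2 => Or.inr ?_⟩
    · intro z h0
      rw [toC, eval_map_algebraMap, ← DL_apply, DL_C_mul, map_mul, aeval_C] at h0
      rcases mul_eq_zero.1 h0 with h0 | h0
      · exact absurd h0 hcC
      · exact real_of_upper _ hnz z h0
    · intro z hz
      have e : (X - C α) * (C c * pS s) = C c * pS ((-α) ::ₘ s) := by
        rw [pS_cons]; simp; ring
      have hK := (main_ind s.card s rfl hs (-α) (by linarith) (by linarith) z hz).1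
      have him := hK.im_nonneg hz
      have hP := hnz z hz
      rw [e, ← DL_apply, ← DL_apply, DL_C_mul, DL_C_mul]
      simp only [toC, eval_add, eval_mul, eval_C, eval_map_algebraMap, map_mul, aeval_C,
        Complex.coe_algebraMap]
      set A := aeval z (DL (pS (-α ::ₘ s)))
      set B := aeval z (DL (pS s))
      have hfac : (c : ℂ) * A + Complex.I * (c * B) = c * B * (A / B + Complex.I) := by
        field_simp
      rw [hfac]
      refine mul_ne_zero (mul_ne_zero hcC hP) ?_
      intro h0
      have := congrArg Complex.im h0
      simp only [Complex.add_im, Complex.I_im, Complex.zero_im] at this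
      linarith
end

section
/- Suppose p = c·Π_{k=1}^n (x − α_k) and q = c′·Π_{k=1}^n (x − β_k), where c, c′ > 0, all α_k and β_k lie in [−1, 0], α_1 ≤ α_2 ≤ ⋯ ≤ α_n, β_1 ≤ β_2 ≤ ⋯ ≤ β_n, and α_k ≤ β_k for every k. Then D(p) ≺ D(q). -/
open Polynomial
open scoped Classical

noncomputable section

namespace DP

def fixP {n : ℕ} (σ : Equiv.Perm (Fin n)) : ℕ :=
  (Finset.univ.filter fun k : Fin n => σ k = k).card

/-- Excedance polynomial of permutations with exactly `j` fixed points. -/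
def dd (n j : ℕ) : ℝ[X] :=
  ∑ σ : Equiv.Perm (Fin n), if fixP σ = j then X ^ excP σ else 0

lemma derangePoly_eq_dd (n : ℕ) : derangePoly n = dd n 0 := by
  unfold derangePoly dd
  rw [Finset.sum_filter]
  refine Finset.sum_congr rfl fun σ _ => ?_
  have : (∀ k, σ k ≠ k) ↔ fixP σ = 0 := by
    simp [fixP, Finset.filter_eq_empty_iff]
  simp only [this]

lemma exc_zero {n : ℕ} (e : Equiv.Perm (Fin n)) :
    excP (Equiv.Perm.decomposeFin.symm (0, e)) = excP e := by
  simp only [excP, Finset.card_filter, Fin.sum_univ_succ, Equiv.Perm.decomposeFin_symm_apply_zero,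
    Equiv.Perm.decomposeFin_symm_apply_succ]
  simp

lemma fix_zero {n : ℕ} (e : Equiv.Perm (Fin n)) :
    fixP (Equiv.Perm.decomposeFin.symm (0, e)) = fixP e + 1 := by
  simp only [fixP, Finset.card_filter, Fin.sum_univ_succ, Equiv.Perm.decomposeFin_symm_apply_zero,
    Equiv.Perm.decomposeFin_symm_apply_succ]
  simp [add_comm]

lemma swap_aux {n : ℕ} (e : Equiv.Perm (Fin n)) (i j : Fin n) :
    Equiv.swap 0 (e i).succ (e j).succ = if j = i then 0 else (e j).succ := by
  split_ifs with h
  · subst h; simp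
  · rw [Equiv.swap_apply_of_ne_of_ne]
    · exact Fin.succ_ne_zero _
    · intro h'
      exact h (e.injective (Fin.succ_injective _ h'))

lemma exc_succ {n : ℕ} (e : Equiv.Perm (Fin n)) (i : Fin n) :
    excP (Equiv.Perm.decomposeFin.symm ((e i).succ, e)) + (if i < e i then 1 else 0)
      = excP e + 1 := by
  simp only [excP, Finset.card_filter, Fin.sum_univ_succ, Equiv.Perm.decomposeFin_symm_apply_zero,
    Equiv.Perm.decomposeFin_symm_apply_succ, swap_aux]
  rw [← Finset.add_sum_erase _ _ (Finset.mem_univ i), ← Finset.add_sum_erase Finset.univ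
    (fun k => if k < e k then 1 else 0) (Finset.mem_univ i)]
  have : ∀ k ∈ Finset.univ.erase i, (if k.succ < (if k = i then 0 else (e k).succ) then 1 else 0)
      = if k < e k then 1 else 0 := by
    intro k hk
    simp [Finset.ne_of_mem_erase hk]
  rw [Finset.sum_congr rfl this]
  simp
  ring

lemma fix_succ {n : ℕ} (e : Equiv.Perm (Fin n)) (i : Fin n) :
    fixP (Equiv.Perm.decomposeFin.symm ((e i).succ, e)) + (if e i = i then 1 else 0)
      = fixP e := by
  simp only [fixP, Finset.card_filter, Fin.sum_univ_succ, Equiv.Perm.decomposeFin_symm_apply_zero,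
    Equiv.Perm.decomposeFin_symm_apply_succ, swap_aux]
  rw [← Finset.add_sum_erase _ _ (Finset.mem_univ i), ← Finset.add_sum_erase Finset.univ
    (fun k => if e k = k then 1 else 0) (Finset.mem_univ i)]
  have : ∀ k ∈ Finset.univ.erase i, (if (if k = i then 0 else (e k).succ) = k.succ then 1 else 0)
      = if e k = k then 1 else 0 := by
    intro k hk
    simp [Finset.ne_of_mem_erase hk]
  rw [Finset.sum_congr rfl this]
  simp [(Fin.succ_ne_zero _).symm]
  ring

lemma X_mul_deriv_pow (k : ℕ) : (X : ℝ[X]) * derivative (X ^ k) = (k : ℝ[X]) * X ^ k := by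
  cases k with
  | zero => simp
  | succ k => simp; ring

/-- Previous-index version of `dd`. -/
def ddp (n : ℕ) : ℕ → ℝ[X]
  | 0 => 0
  | j + 1 => dd n j

lemma dd_succ (n j : ℕ) : dd (n + 1) j = ddp n j + X * ((j : ℝ[X]) + 1) * dd n (j + 1)
    + X * (1 - X) * derivative (dd n j) + X * ((n : ℝ[X]) - (j : ℝ[X])) * dd n j := by
  have h1 : dd (n + 1) j = ∑ e : Equiv.Perm (Fin n), ∑ p : Fin (n + 1),
      (if fixP (Equiv.Perm.decomposeFin.symm (p, e)) = j then
        (X : ℝ[X]) ^ excP (Equiv.Perm.decomposeFin.symm (p, e)) else 0) := by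
    unfold dd
    rw [← Equiv.sum_comp (Equiv.Perm.decomposeFin (n := n)).symm, Fintype.sum_prod_type_right]
  have h2 : ddp n j = ∑ e : Equiv.Perm (Fin n), if fixP e + 1 = j then (X : ℝ[X]) ^ excP e else 0 := by
    cases j with
    | zero => simp [ddp]
    | succ j => simp [ddp, dd]
  rw [h1, h2]
  unfold dd
  rw [derivative_sum]
  simp only [Finset.mul_sum]
  rw [← Finset.sum_add_distrib, ← Finset.sum_add_distrib, ← Finset.sum_add_distrib]
  refine Finset.sum_congr rfl fun e _ => ?_
  rw [Fin.sum_univ_succ, exc_zero, fix_zero, add_assoc, add_assoc]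
  congr 1
  rw [← Equiv.sum_comp e]
  have key : ∀ i : Fin n,
      (if fixP (Equiv.Perm.decomposeFin.symm ((e i).succ, e)) = j then
        (X : ℝ[X]) ^ excP (Equiv.Perm.decomposeFin.symm ((e i).succ, e)) else 0)
      = (if i < e i then 1 else 0) * (if fixP e = j then (1 - X) * X ^ excP e else 0)
       + (if e i = i then 1 else 0) * ((if fixP e = j + 1 then X * X ^ excP e else 0)
          - (if fixP e = j then X * X ^ excP e else 0))
       + (if fixP e = j then X * X ^ excP e else 0) := by
    intro i
    have a1 := exc_succ e i
    have a2 := fix_succ e i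
    rcases lt_trichotomy i (e i) with h | h | h
    · rw [if_pos h] at a1
      rw [if_neg h.ne'] at a2
      simp only [h, h.ne', if_true, if_false]
      have a1' : excP (Equiv.Perm.decomposeFin.symm ((e i).succ, e)) = excP e := by omega
      have a2' : fixP (Equiv.Perm.decomposeFin.symm ((e i).succ, e)) = fixP e := by omega
      rw [a1', a2']
      split_ifs <;> ring
    · rw [if_neg h.not_lt] at a1
      rw [if_pos h.symm] at a2
      simp only [h.symm, if_true]
      rw [← h] at a1 a2
      have a1' : excP (Equiv.Perm.decomposeFin.symm (i.succ, e)) = excP e + 1 := by omega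
      have a2' : (fixP (Equiv.Perm.decomposeFin.symm (i.succ, e)) = j) ↔ fixP e = j + 1 := by omega
      simp only [a1', a2']
      simp only [lt_irrefl, if_false]
      split_ifs <;> ring
    · rw [if_neg h.not_gt] at a1
      rw [if_neg h.ne] at a2
      simp only [h.not_gt, h.ne, if_false]
      have a1' : excP (Equiv.Perm.decomposeFin.symm ((e i).succ, e)) = excP e + 1 := by omega
      have a2' : fixP (Equiv.Perm.decomposeFin.symm ((e i).succ, e)) = fixP e := by omega
      rw [a1', a2']
      split_ifs <;> ring
  rw [Finset.sum_congr rfl fun i _ => key i, Finset.sum_add_distrib, Finset.sum_add_distrib,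
    ← Finset.sum_mul, ← Finset.sum_mul, Finset.sum_boole, Finset.sum_boole]
  have c1 : (Finset.univ.filter fun k : Fin n => k < e k).card = excP e := rfl
  have c2 : (Finset.univ.filter fun k : Fin n => e k = k).card = fixP e := rfl
  rw [c1, c2]
  have hd := X_mul_deriv_pow (excP e)
  simp only [Finset.sum_const, Finset.card_univ, Fintype.card_fin, nsmul_eq_mul]
  by_cases hj : fixP e = j
  · have hj' : ¬ fixP e = j + 1 := by omega
    rw [if_pos hj, if_neg hj', if_pos hj, if_neg hj', if_pos hj]
    rw [hj]
    linear_combination (-(1 - X)) * hd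
  · by_cases hj' : fixP e = j + 1
    · rw [if_neg hj, if_pos hj', if_neg hj, if_pos hj', if_neg hj, hj']
      simp
      ring
    · rw [if_neg hj, if_neg hj', if_neg hj, if_neg hj', if_neg hj]
      simp

lemma dd_zero_succ (j : ℕ) : dd 0 (j + 1) = 0 := by
  simp [dd, fixP]

lemma dd_ratio (n : ℕ) : ∀ j : ℕ, ((j : ℝ[X]) + 1) * dd (n + 1) (j + 1) = ((n : ℝ[X]) + 1) * dd n j := by
  induction n with
  | zero =>
    intro j
    rw [dd_succ, dd_zero_succ, dd_zero_succ]
    cases j <;> simp [ddp, dd_zero_succ]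
  | succ n ih =>
    intro j
    rw [dd_succ (n + 1) (j + 1)]
    have i1 := ih j
    have i2 := ih (j + 1)
    have i3 : (j : ℝ[X]) * dd (n + 1) j = ((n : ℝ[X]) + 1) * ddp n j := by
      cases j with
      | zero => simp [ddp]
      | succ j => simpa [ddp] using ih j
    have i1' := congrArg derivative i1
    simp only [derivative_mul, derivative_add, derivative_natCast, derivative_one, zero_add,
      zero_mul] at i1'
    have r := dd_succ n j
    simp only [ddp]
    push_cast at i2 ⊢
    linear_combination ((j : ℝ[X]) + 1) * X * i2 + X * (1 - X) * i1' + X * ((n : ℝ[X]) - (j : ℝ[X])) * i1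
      - ((n : ℝ[X]) + 1) * r + i3

lemma derangePoly_zero : derangePoly 0 = 1 := by
  simp [derangePoly, excP]

lemma derangePoly_one : derangePoly 1 = 0 := by
  rw [derangePoly_eq_dd, dd_succ]
  have := derangePoly_zero
  rw [derangePoly_eq_dd] at this
  simp [ddp, this, dd_zero_succ]

lemma derangePoly_rec (n : ℕ) : derangePoly (n + 2) = X * (1 - X) * derivative (derangePoly (n + 1))
    + ((n : ℝ[X]) + 1) * X * (derangePoly (n + 1) + derangePoly n) := by
  simp only [derangePoly_eq_dd]
  rw [dd_succ (n + 1) 0]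
  have := dd_ratio n 0
  simp only [ddp]
  push_cast at this ⊢
  linear_combination X * this

lemma derangePoly_natDegree (n : ℕ) : (derangePoly n).natDegree ≤ n - 1 := by
  unfold derangePoly
  refine natDegree_sum_le_of_forall_le _ _ fun σ _ => ?_
  rw [natDegree_X_pow]
  cases n with
  | zero => simp [excP]
  | succ n =>
    have : (Finset.univ.filter fun k : Fin (n + 1) => k < σ k) ⊆ Finset.univ.erase (Fin.last n) := by
      intro k hk
      simp only [Finset.mem_filter, Finset.mem_univ, true_and] at hk
      simp only [Finset.mem_erase, Finset.mem_univ, and_true]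
      rintro rfl
      exact absurd (Fin.le_last _) (not_le.2 hk)
    simpa [excP] using Finset.card_le_card this

lemma derangePoly_coeff_nonneg (n k : ℕ) : 0 ≤ (derangePoly n).coeff k := by
  unfold derangePoly
  rw [finsetSum_coeff]
  refine Finset.sum_nonneg fun σ _ => ?_
  rw [coeff_X_pow]
  split_ifs <;> norm_num

lemma exc_inv {n : ℕ} (σ : Equiv.Perm (Fin n)) (h : ∀ k, σ k ≠ k) :
    excP σ⁻¹ + excP σ = n := by
  have h1 : excP σ⁻¹ = (Finset.univ.filter fun k : Fin n => σ k < k).card := by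
    unfold excP
    rw [Finset.card_filter, Finset.card_filter, ← Equiv.sum_comp σ]
    simp
  rw [h1]
  unfold excP
  rw [Finset.card_filter, Finset.card_filter, ← Finset.sum_add_distrib]
  have : ∀ k ∈ (Finset.univ : Finset (Fin n)),
      ((if σ k < k then 1 else 0) + (if k < σ k then 1 else 0)) = 1 := by
    intro k _
    rcases lt_or_gt_of_ne (h k) with h | h
    · simp [h, h.not_gt]
    · simp [h, h.not_gt]
  rw [Finset.sum_congr rfl this]
  simp

lemma derangePoly_symm (n : ℕ) (z : ℂ) (hz : z ≠ 0) :
    aeval z (derangePoly n) = z ^ n * aeval z⁻¹ (derangePoly n) := by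
  unfold derangePoly
  rw [map_sum, map_sum, Finset.mul_sum]
  refine Finset.sum_bij' (fun σ _ => σ⁻¹) (fun σ _ => σ⁻¹) ?_ ?_ ?_ ?_ ?_
  · intro σ hσ
    simp only [Finset.mem_filter, Finset.mem_univ, true_and] at hσ ⊢
    intro k hk
    exact hσ k (by conv_lhs => rw [← hk]; simp)
  · intro σ hσ
    simp only [Finset.mem_filter, Finset.mem_univ, true_and] at hσ ⊢
    intro k hk
    exact hσ k (by conv_lhs => rw [← hk]; simp)
  · simp
  · simp
  · intro σ hσ
    simp only [Finset.mem_filter, Finset.mem_univ, true_and] at hσ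
    simp only [map_pow, aeval_X]
    have := exc_inv σ hσ
    have h2 : z ^ n = z ^ excP σ⁻¹ * z ^ excP σ := by rw [← pow_add, this]
    rw [h2, inv_pow]
    field_simp

end DP

end

noncomputable section

namespace DP

/-- The operator `D` as a linear map. -/
def DL : ℝ[X] →ₗ[ℝ] ℝ[X] :=
  Polynomial.lsum (fun k => LinearMap.toSpanSingleton ℝ ℝ[X] (derangePoly k))

lemma DL_apply (p : ℝ[X]) : DL p = p.sum fun k a => a • derangePoly k := by
  simp [DL, Polynomial.lsum_apply]

lemma Dmap_eq (p : ℝ[X]) : Dmap p = DL p := by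
  rw [DL_apply, Polynomial.sum_over_range]
  · rfl
  · intro n; simp

lemma DL_X_pow (n : ℕ) : DL (X ^ n) = derangePoly n := by
  rw [DL_apply, ← monomial_one_right_eq_X_pow, sum_monomial_index] <;> simp

lemma DL_rec (p : ℝ[X]) : DL (X * p) = X * (1 - X) * derivative (DL p)
    + X * DL ((X + 1) * derivative p) := by
  induction p using Polynomial.induction_on' with
  | add p q hp hq =>
    simp only [mul_add, map_add, hp, hq]
    ring
  | monomial n a =>
    have h0 : monomial n a = a • (X : ℝ[X]) ^ n := by
      rw [← monomial_one_right_eq_X_pow, smul_monomial]; simp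
    have h1 : DL (X * X ^ n) = X * (1 - X) * derivative (DL (X ^ n))
        + X * DL ((X + 1) * derivative (X ^ n)) := by
      rw [← pow_succ', DL_X_pow, DL_X_pow]
      cases n with
      | zero => simp [derangePoly_zero, derangePoly_one]
      | succ n =>
        have : (X + 1) * derivative ((X : ℝ[X]) ^ (n + 1)) = ((n : ℝ) + 1) • (X ^ (n + 1) + X ^ n) := by
          rw [derivative_X_pow, smul_eq_C_mul]
          simp
          ring
        rw [this, derangePoly_rec, map_smul, map_add, DL_X_pow, DL_X_pow, smul_eq_C_mul]
        simp
        ring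
    rw [h0]
    simp only [mul_smul_comm, map_smul, h1, smul_add]

/-- product of `X + a`. -/
def pr (s : Multiset ℝ) : ℝ[X] := (s.map fun a => X + C a).prod

def U (s : Multiset ℝ) : ℝ[X] := DL (pr s)
def V (s : Multiset ℝ) : ℝ[X] := DL (X * pr s)

lemma pr_cons (a : ℝ) (s : Multiset ℝ) : pr (a ::ₘ s) = (X + C a) * pr s := by
  simp [pr]

lemma U_cons (a : ℝ) (s : Multiset ℝ) : U (a ::ₘ s) = V s + a • U s := by
  rw [U, pr_cons, add_mul, map_add, ← smul_eq_C_mul, map_smul]; rfl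

lemma U_zero : U 0 = 1 := by
  have := DL_X_pow 0
  simp only [pow_zero] at this
  simp [U, pr, this, derangePoly_zero]

lemma V_zero : V 0 = 0 := by
  have := DL_X_pow 1
  simp only [pow_one] at this
  simp [V, pr, this, derangePoly_one]

lemma V_eq (s : Multiset ℝ) : V s = X * (1 - X) * derivative (U s)
    + X * ((s.card : ℝ[X]) * U s + (s.map fun a => (1 - a) • U (s.erase a)).sum) := by
  unfold V
  rw [DL_rec]
  congr 2
  have : (X + 1) * derivative (pr s) = (s.map fun a => pr s + (1 - a) • pr (s.erase a)).sum := by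
    unfold pr
    rw [derivative_prod, ← Multiset.sum_map_mul_left]
    congr 1
    refine Multiset.map_congr rfl fun a ha => ?_
    have h : (s.map fun a => (X : ℝ[X]) + C a).prod = (X + C a) * ((s.erase a).map fun a => X + C a).prod := by
      conv_lhs => rw [← Multiset.cons_erase ha]
      simp
    rw [h, smul_eq_C_mul]
    simp
    ring
  rw [this, Multiset.sum_map_add, map_add, map_multiset_sum, map_multiset_sum, Multiset.map_map,
    Multiset.map_map]
  simp [U]

lemma pr_natDegree (s : Multiset ℝ) : (pr s).natDegree = s.card := by
  unfold pr
  rw [natDegree_multiset_prod_of_monic]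
  · simp
  · intro f hf
    obtain ⟨a, _, rfl⟩ := Multiset.mem_map.1 hf
    exact monic_X_add_C a

lemma U_natDegree (s : Multiset ℝ) : (U s).natDegree ≤ s.card - 1 := by
  unfold U
  rw [DL_apply, Polynomial.sum_over_range _ (by simp), pr_natDegree]
  refine natDegree_sum_le_of_forall_le _ _ fun k hk => ?_
  refine (natDegree_smul_le _ _).trans ((derangePoly_natDegree k).trans ?_)
  have := Finset.mem_range.1 hk
  omega

lemma pr_coeff_nonneg (s : Multiset ℝ) (hs : ∀ a ∈ s, 0 ≤ a) (k : ℕ) : 0 ≤ (pr s).coeff k := by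
  induction s using Multiset.induction_on generalizing k with
  | empty => simp [pr, coeff_one]; split_ifs <;> norm_num
  | cons a s ih =>
    have ih' := ih fun b hb => hs b (Multiset.mem_cons_of_mem hb)
    have ha := hs a (Multiset.mem_cons_self a s)
    rw [pr_cons, add_mul, coeff_add, coeff_C_mul]
    cases k with
    | zero => simpa using mul_nonneg ha (ih' 0)
    | succ k => rw [coeff_X_mul]; exact add_nonneg (ih' k) (mul_nonneg ha (ih' _))

lemma U_coeff_nonneg (s : Multiset ℝ) (hs : ∀ a ∈ s, 0 ≤ a) (k : ℕ) : 0 ≤ (U s).coeff k := by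
  unfold U
  rw [DL_apply, Polynomial.sum_over_range _ (by simp), finsetSum_coeff]
  refine Finset.sum_nonneg fun j _ => ?_
  rw [coeff_smul, smul_eq_mul]
  exact mul_nonneg (pr_coeff_nonneg s hs j) (derangePoly_coeff_nonneg j k)

lemma eval_pos_of_coeff_nonneg (u : ℝ[X]) (hu : u ≠ 0) (h : ∀ k, 0 ≤ u.coeff k) (x : ℝ) (hx : 0 < x) :
    0 < u.eval x := by
  rw [eval_eq_sum_range]
  refine Finset.sum_pos' (fun i _ => mul_nonneg (h i) (pow_pos hx i).le) ⟨u.natDegree, by simp, ?_⟩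
  have : 0 < u.coeff u.natDegree := lt_of_le_of_ne (h _) (Ne.symm (by simpa using hu))
  positivity

lemma aeval_conj' (u : ℝ[X]) (z : ℂ) : aeval (starRingEnd ℂ z) u = starRingEnd ℂ (aeval z u) := by
  exact Polynomial.aeval_conj u z

lemma root_props (u : ℝ[X]) (h : ∀ k, 0 ≤ u.coeff k)
    (hH : ∀ z : ℂ, 0 < z.im → aeval z u ≠ 0) (t : ℂ) (ht : aeval t u = 0) : t.im = 0 ∧ t.re ≤ 0 := by
  have hu : u ≠ 0 := by
    rintro rfl
    exact hH Complex.I (by simp) (by simp)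
  have him : t.im = 0 := by
    rcases lt_trichotomy t.im 0 with h1 | h1 | h1
    · exfalso
      refine hH (starRingEnd ℂ t) (by simpa using h1) ?_
      rw [aeval_conj', ht, map_zero]
    · exact h1
    · exact absurd ht (hH t h1)
  refine ⟨him, ?_⟩
  by_contra! hre
  have e : t = ((t.re : ℝ) : ℂ) := by apply Complex.ext <;> simp [him]
  have := eval_pos_of_coeff_nonneg u hu h t.re hre
  rw [e] at ht
  have h2 : aeval ((t.re : ℝ) : ℂ) u = ((u.eval t.re : ℝ) : ℂ) := by
    have := Polynomial.aeval_algebraMap_apply ℂ t.re u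
    simpa using this
  rw [h2] at ht
  exact this.ne' (by exact_mod_cast ht)

lemma single_a (z t : ℂ) (hz : 0 < z.im) (h1 : t.im = 0) (h2 : t.re ≤ 0) :
    -z.im ≤ (z * (1 - z) * (1 / (z - t))).im := by
  have hne : z - t ≠ 0 := by
    intro h; have := congrArg Complex.im h; simp [h1] at this; exact hz.ne' this
  have e : z * (1 - z) * (1 / (z - t)) = (1 - z - t) + t * (1 - t) * (z - t)⁻¹ := by
    field_simp; ring
  have e2 : t = ((t.re : ℝ) : ℂ) := by apply Complex.ext <;> simp [h1]
  have e3 : t * (1 - t) = ((t.re * (1 - t.re) : ℝ) : ℂ) := by rw [e2]; simp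
  rw [e, e3, Complex.add_im, Complex.im_ofReal_mul, Complex.inv_im]
  have : 0 ≤ (z - t).im / Complex.normSq (z - t) :=
    div_nonneg (by simp [h1, hz.le]) (Complex.normSq_nonneg _)
  have h3 : t.re * (1 - t.re) ≤ 0 := mul_nonpos_of_nonpos_of_nonneg h2 (by linarith)
  have h4 := mul_nonneg_of_nonpos_of_nonpos h3 (neg_nonpos.2 this)
  rw [neg_div]
  simp only [Complex.sub_im, Complex.one_im, h1] at h4 ⊢
  linarith

lemma single_b (z t : ℂ) (hz : 0 < z.im) (h1 : t.im = 0) (h2 : t.re ≤ 0) :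
    ((1 - z) * (1 / (z - t))).im ≤ 0 := by
  have hne : z - t ≠ 0 := by
    intro h; have := congrArg Complex.im h; simp [h1] at this; exact hz.ne' this
  have e : (1 - z) * (1 / (z - t)) = -1 + (1 - t) * (z - t)⁻¹ := by
    field_simp; ring
  have e2 : t = ((t.re : ℝ) : ℂ) := by apply Complex.ext <;> simp [h1]
  have e3 : (1 - t) = (((1 - t.re) : ℝ) : ℂ) := by rw [e2]; simp
  rw [e, e3, Complex.add_im, Complex.im_ofReal_mul, Complex.inv_im]
  have : 0 ≤ (z - t).im / Complex.normSq (z - t) :=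
    div_nonneg (by simp [h1, hz.le]) (Complex.normSq_nonneg _)
  have h4 := mul_nonneg (by linarith : (0:ℝ) ≤ 1 - t.re) this
  rw [neg_div]
  simp only [Complex.neg_im, Complex.one_im] at h4 ⊢
  linarith

lemma multi_a (z : ℂ) (hz : 0 < z.im) (m : Multiset ℂ) (hm : ∀ t ∈ m, t.im = 0 ∧ t.re ≤ 0) :
    -(m.card * z.im) ≤ (z * (1 - z) * (m.map fun t => 1 / (z - t)).sum).im := by
  induction m using Multiset.induction_on with
  | empty => simp
  | cons t m ih =>
    have ih' := ih fun b hb => hm b (Multiset.mem_cons_of_mem hb)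
    have ht := hm t (Multiset.mem_cons_self t m)
    have := single_a z t hz ht.1 ht.2
    rw [Multiset.map_cons, Multiset.sum_cons, mul_add, Complex.add_im, Multiset.card_cons]
    push_cast
    linarith

lemma multi_b (z : ℂ) (hz : 0 < z.im) (m : Multiset ℂ) (hm : ∀ t ∈ m, t.im = 0 ∧ t.re ≤ 0) :
    ((1 - z) * (m.map fun t => 1 / (z - t)).sum).im ≤ 0 := by
  induction m using Multiset.induction_on with
  | empty => simp
  | cons t m ih =>
    have ih' := ih fun b hb => hm b (Multiset.mem_cons_of_mem hb)
    have ht := hm t (Multiset.mem_cons_self t m)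
    have := single_b z t hz ht.1 ht.2
    rw [Multiset.map_cons, Multiset.sum_cons, mul_add, Complex.add_im]
    linarith

lemma logderiv (u : ℝ[X]) (h : ∀ k, 0 ≤ u.coeff k)
    (hH : ∀ z : ℂ, 0 < z.im → aeval z u ≠ 0) (z : ℂ) (hz : 0 < z.im) :
    -(u.natDegree * z.im) ≤ (z * (1 - z) * (aeval z (derivative u) / aeval z u)).im ∧
    ((1 - z) * (aeval z (derivative u) / aeval z u)).im ≤ 0 := by
  set P : ℂ[X] := u.map (algebraMap ℝ ℂ) with hP
  have e1 : ∀ q : ℝ[X], aeval z q = (q.map (algebraMap ℝ ℂ)).eval z := fun q => by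
    rw [eval_map_algebraMap]
  have hs : P.Splits := IsAlgClosed.splits P
  have hne : P.eval z ≠ 0 := by rw [hP, ← e1]; exact hH z hz
  have e2 := hs.eval_derivative_div_eval_of_ne_zero hne
  have e3 : aeval z (derivative u) / aeval z u = (P.roots.map fun t => 1 / (z - t)).sum := by
    rw [← e2, e1, e1, ← derivative_map]
  have hr : ∀ t ∈ P.roots, t.im = 0 ∧ t.re ≤ 0 := by
    intro t ht
    refine root_props u h hH t ?_
    have := isRoot_of_mem_roots ht
    rw [← eval_map_algebraMap]; exact this
  have hc : P.roots.card = u.natDegree := by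
    rw [← hs.natDegree_eq_card_roots, hP, natDegree_map]
  rw [e3, ← hc]
  exact ⟨multi_a z hz _ hr, multi_b z hz _ hr⟩

end DP

end

noncomputable section

namespace DP

lemma inv_im_nonpos {w : ℂ} (h : 0 ≤ w.im) : (w⁻¹).im ≤ 0 := by
  rw [Complex.inv_im, neg_div]
  exact neg_nonpos.2 (div_nonneg h (Complex.normSq_nonneg _))

lemma inv_im_nonneg {w : ℂ} (h : w.im ≤ 0) : 0 ≤ (w⁻¹).im := by
  rw [Complex.inv_im]
  exact div_nonneg (by linarith) (Complex.normSq_nonneg _)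

lemma ratio_lem (u v z : ℂ) (a : ℝ) (ha : 0 ≤ a) (hz : 0 < z.im) (h1 : 0 ≤ (v / u).im)
    (h2 : (v / (z * u)).im ≤ 0) :
    (u / (v + a * u)).im ≤ 0 ∧ 0 ≤ (z * (u / (v + a * u))).im := by
  by_cases hu : u = 0
  · simp [hu]
  have hz0 : z ≠ 0 := by rintro rfl; simp at hz
  constructor
  · have e : u / (v + a * u) = (v / u + a)⁻¹ := by
      rw [div_add' _ _ _ hu, inv_div]
    rw [e]
    apply inv_im_nonpos
    simpa using h1
  · have e : z * (u / (v + a * u)) = (v / (z * u) + a * z⁻¹)⁻¹ := by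
      rw [← inv_inj, inv_inv]
      rw [mul_inv, inv_div]
      field_simp
    rw [e]
    apply inv_im_nonneg
    rw [Complex.add_im, Complex.im_ofReal_mul]
    have := mul_nonpos_of_nonneg_of_nonpos ha (inv_im_nonpos hz.le)
    linarith

lemma sum_im_nonneg {ι : Type*} (s : Multiset ι) (f : ι → ℂ) (h : ∀ a ∈ s, 0 ≤ (f a).im) :
    0 ≤ ((s.map f).sum).im := by
  induction s using Multiset.induction_on with
  | empty => simp
  | cons a s ih =>
    rw [Multiset.map_cons, Multiset.sum_cons, Complex.add_im]
    exact add_nonneg (h a (Multiset.mem_cons_self a s))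
      (ih fun b hb => h b (Multiset.mem_cons_of_mem hb))

lemma sum_im_nonpos {ι : Type*} (s : Multiset ι) (f : ι → ℂ) (h : ∀ a ∈ s, (f a).im ≤ 0) :
    ((s.map f).sum).im ≤ 0 := by
  induction s using Multiset.induction_on with
  | empty => simp
  | cons a s ih =>
    rw [Multiset.map_cons, Multiset.sum_cons, Complex.add_im]
    exact add_nonpos (h a (Multiset.mem_cons_self a s))
      (ih fun b hb => h b (Multiset.mem_cons_of_mem hb))

lemma aeval_U_cons (z : ℂ) (a : ℝ) (s : Multiset ℝ) :
    aeval z (U (a ::ₘ s)) = aeval z (V s) + a * aeval z (U s) := by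
  rw [U_cons, map_add, map_smul, Complex.real_smul]

lemma aeval_V (z : ℂ) (s : Multiset ℝ) : aeval z (V s) = z * (1 - z) * aeval z (derivative (U s))
    + z * ((s.card : ℂ) * aeval z (U s)
      + (s.map fun a : ℝ => ((1 - a : ℝ) : ℂ) * aeval z (U (s.erase a))).sum) := by
  rw [V_eq]
  simp only [map_add, map_mul, map_sub, map_one, aeval_X, map_natCast, map_multiset_sum,
    Multiset.map_map, Function.comp_def, map_smul, Complex.real_smul]

lemma U_single (a : ℝ) : U {a} = C a := by
  have : ({a} : Multiset ℝ) = a ::ₘ 0 := rfl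
  rw [this, U_cons, V_zero, U_zero, smul_eq_C_mul]; simp

lemma key (N : ℕ) : ∀ s : Multiset ℝ, s.card = N → (∀ a ∈ s, 0 ≤ a ∧ a ≤ 1) →
    (N ≠ 1 → ∀ z : ℂ, 0 < z.im → aeval z (U s) ≠ 0) ∧
    ∀ z : ℂ, 0 < z.im → 0 ≤ (aeval z (V s) / aeval z (U s)).im ∧
      (aeval z (V s) / (z * aeval z (U s))).im ≤ 0 ∧
      (1 ≤ N → aeval z (U s) ≠ 0 → 0 < (aeval z (V s) / aeval z (U s)).im) := by
  induction N using Nat.strong_induction_on with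
  | _ N IH =>
  intro s hN hs
  have hnv : N ≠ 1 → ∀ z : ℂ, 0 < z.im → aeval z (U s) ≠ 0 := by
    intro hN1 z hz
    induction s using Multiset.induction_on with
    | empty => simp [U_zero]
    | cons a t _ =>
      rw [Multiset.card_cons] at hN
      have ht := IH t.card (by omega) t rfl fun b hb => hs b (Multiset.mem_cons_of_mem hb)
      rw [aeval_U_cons]
      by_cases hU : aeval z (U t) = 0
      · have hc : t.card = 1 := by
          by_contra hc
          exact ht.1 hc z hz hU
        obtain ⟨b, rfl⟩ := Multiset.card_eq_one.1 hc
        have hb : b = 0 := by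
          rw [U_single] at hU
          simpa using hU
        subst hb
        rw [hU, aeval_V, U_single]
        have hz0 : z ≠ 0 := by rintro rfl; simp at hz
        simpa [U_zero] using hz0
      · intro h
        have h3 := (ht.2 z hz).2.2 (by omega) hU
        have : aeval z (V t) / aeval z (U t) = ((-a : ℝ) : ℂ) := by
          rw [div_eq_iff hU]; push_cast; linear_combination h
        rw [this] at h3
        simp at h3
  refine ⟨hnv, fun z hz => ?_⟩
  by_cases hU : aeval z (U s) = 0
  · simp [hU]
  have hz0 : z ≠ 0 := by rintro rfl; simp at hz
  have hnv' : ∀ w : ℂ, 0 < w.im → aeval w (U s) ≠ 0 := by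
    by_cases hN1 : N = 1
    · have hd := U_natDegree s
      rw [hN, hN1] at hd
      rw [eq_C_of_natDegree_le_zero hd] at hU ⊢
      intro w _
      simpa using hU
    · exact hnv hN1
  have hld := logderiv (U s) (U_coeff_nonneg s fun a ha => (hs a ha).1) hnv' z hz
  have hrat : ∀ a ∈ s, (aeval z (U (s.erase a)) / aeval z (U s)).im ≤ 0 ∧
      0 ≤ (z * (aeval z (U (s.erase a)) / aeval z (U s))).im := by
    intro a ha
    have hcard : (s.erase a).card + 1 = N := by
      rw [Multiset.card_erase_add_one ha, hN]
    have h := (IH (s.erase a).card (by omega) (s.erase a) rfl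
      fun b hb => hs b (Multiset.mem_of_mem_erase hb)).2 z hz
    have e : aeval z (U s) = aeval z (V (s.erase a)) + a * aeval z (U (s.erase a)) := by
      rw [← aeval_U_cons, Multiset.cons_erase ha]
    rw [e]
    exact ratio_lem _ _ z a (hs a ha).1 hz h.1 h.2.1
  have e1 : aeval z (V s) / aeval z (U s)
      = z * (1 - z) * (aeval z (derivative (U s)) / aeval z (U s)) + (s.card : ℝ) * z
        + (s.map fun a : ℝ => ((1 - a : ℝ) : ℂ)
          * (z * (aeval z (U (s.erase a)) / aeval z (U s)))).sum := by
    rw [div_eq_iff hU, add_mul, add_mul, ← Multiset.sum_map_mul_right, aeval_V, mul_add,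
      ← Multiset.sum_map_mul_left, add_assoc]
    congr 1
    · field_simp
    · congr 1
      · push_cast; ring
      · congr 1
        refine Multiset.map_congr rfl fun a _ => ?_
        field_simp
  have e2 : aeval z (V s) / (z * aeval z (U s))
      = (1 - z) * (aeval z (derivative (U s)) / aeval z (U s)) + (s.card : ℝ)
        + (s.map fun a : ℝ => ((1 - a : ℝ) : ℂ)
          * (aeval z (U (s.erase a)) / aeval z (U s))).sum := by
    have : aeval z (V s) / (z * aeval z (U s)) = z⁻¹ * (aeval z (V s) / aeval z (U s)) := by
      field_simp
    rw [this, e1, mul_add, mul_add, ← Multiset.sum_map_mul_left]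
    congr 1
    · congr 1 <;> field_simp
    · congr 1
      refine Multiset.map_congr rfl fun a _ => ?_
      field_simp
  have hdeg : ((U s).natDegree : ℝ) ≤ (N : ℝ) := by
    have := U_natDegree s
    exact_mod_cast (by omega : (U s).natDegree ≤ N)
  have hsum : 0 ≤ ((s.map fun a : ℝ => ((1 - a : ℝ) : ℂ)
          * (z * (aeval z (U (s.erase a)) / aeval z (U s)))).sum).im := by
    refine sum_im_nonneg _ _ fun a ha => ?_
    rw [Complex.im_ofReal_mul]
    exact mul_nonneg (by linarith [(hs a ha).2]) (hrat a ha).2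
  have him : (((s.card : ℝ) : ℂ) * z).im = N * z.im := by
    rw [Complex.im_ofReal_mul, hN]
  refine ⟨?_, ?_, ?_⟩
  · rw [e1, Complex.add_im, Complex.add_im, him]
    have := mul_le_mul_of_nonneg_right hdeg hz.le
    linarith [hld.1]
  · rw [e2, Complex.add_im, Complex.add_im, Complex.ofReal_im]
    have : ((s.map fun a : ℝ => ((1 - a : ℝ) : ℂ)
          * (aeval z (U (s.erase a)) / aeval z (U s))).sum).im ≤ 0 := by
      refine sum_im_nonpos _ _ fun a ha => ?_
      rw [Complex.im_ofReal_mul]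
      exact mul_nonpos_of_nonneg_of_nonpos (by linarith [(hs a ha).2]) (hrat a ha).1
    linarith [hld.2]
  · intro hN1 _
    rw [e1, Complex.add_im, Complex.add_im, him]
    have hdeg' : ((U s).natDegree : ℝ) + 1 ≤ (N : ℝ) := by
      have := U_natDegree s
      exact_mod_cast (by omega : (U s).natDegree + 1 ≤ N)
    have := mul_le_mul_of_nonneg_right hdeg' hz.le
    linarith [hld.1]

end DP

end

noncomputable section

namespace DP

open Filter Topology

/-- The open upper half plane. -/
def HP : Set ℂ := {z | 0 < z.im}

lemma AU_rec (n : ℕ) : U (Multiset.replicate (n + 1) 1) = X * (1 - X) * derivative (U (Multiset.replicate n 1))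
    + ((n : ℝ[X]) * X + 1) * U (Multiset.replicate n 1) := by
  rw [Multiset.replicate_succ, U_cons, V_eq]
  have : ((Multiset.replicate n (1 : ℝ)).map fun a => (1 - a) • U ((Multiset.replicate n 1).erase a)).sum = 0 := by
    rw [Multiset.map_replicate]; simp
  rw [this]
  simp
  ring

lemma AU_symm (n : ℕ) : ∀ z : ℂ, z ≠ 0 → aeval z (U (Multiset.replicate (n + 1) 1))
    = z ^ n * aeval z⁻¹ (U (Multiset.replicate (n + 1) 1)) := by
  induction n with
  | zero => intro z hz; simp [U_single]
  | succ m ih =>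
    intro z hz
    rw [AU_rec]
    set P := U (Multiset.replicate (m + 1) 1) with hP
    have hPz := ih z hz
    have h1 : HasDerivAt (fun z : ℂ => aeval z P) (aeval z (derivative P)) z := P.hasDerivAt_aeval z
    have h2 : HasDerivAt (fun z : ℂ => z ^ m * aeval z⁻¹ P)
        (m * z ^ (m - 1) * aeval z⁻¹ P + z ^ m * (aeval z⁻¹ (derivative P) * (-(z ^ 2)⁻¹))) z := by
      have h3 : HasDerivAt (fun z : ℂ => aeval z⁻¹ P) (aeval z⁻¹ (derivative P) * (-(z ^ 2)⁻¹)) z :=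
        HasDerivAt.comp z (P.hasDerivAt_aeval z⁻¹) (hasDerivAt_inv hz)
      exact (hasDerivAt_pow m z).mul h3
    have h4 : (fun z : ℂ => aeval z P) =ᶠ[𝓝 z] fun z => z ^ m * aeval z⁻¹ P := by
      filter_upwards [isOpen_ne.mem_nhds hz] with w hw using ih w hw
    have h5 := h1.unique (h2.congr_of_eventuallyEq h4)
    have h6 : (m : ℂ) * z ^ (m - 1) * z = m * z ^ m := by
      cases m with
      | zero => simp
      | succ m => simp [pow_succ]; ring
    have h7 : z ^ m * z⁻¹ * aeval z⁻¹ (derivative P) = m * aeval z P - z * aeval z (derivative P) := by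
      rw [h5, hPz]
      have : z * (z ^ 2)⁻¹ = z⁻¹ := by field_simp
      linear_combination (aeval z⁻¹ P) * h6 - z ^ m * aeval z⁻¹ (derivative P) * this
    simp only [map_add, map_mul, map_sub, map_one, aeval_X, map_natCast]
    push_cast
    have hzz : z * z⁻¹ = 1 := mul_inv_cancel₀ hz
    rw [pow_succ]
    set Q' := aeval z⁻¹ (derivative P)
    set Q := aeval z⁻¹ P
    have e : z ^ m * z * (z⁻¹ * (1 - z⁻¹) * Q' + (((m : ℂ) + 1) * z⁻¹ + 1) * Q)
        = (z - 1) * (z ^ m * z⁻¹ * Q') + ((m : ℂ) + 1 + z) * (z ^ m * Q) := by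
      field_simp
    rw [e, h7, ← hPz]
    ring

lemma U_zeros (n : ℕ) : U (Multiset.replicate n 0) = derangePoly n := by
  simp [U, pr, DL_X_pow]

/-- `g = r e^{iθ} f` on the upper half plane with a nonnegative continuous `θ` vanishing at `1`. -/
def Lift (f g : ℂ → ℂ) (θ : ℂ → ℝ) : Prop :=
  ContinuousOn θ HP ∧ (∀ z ∈ HP, 0 ≤ θ z) ∧ Tendsto θ (𝓝[HP] 1) (𝓝 0) ∧
    ∀ z ∈ HP, ∃ r : ℝ, 0 < r ∧ g z = r * Complex.exp (θ z * Complex.I) * f z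

lemma Lift.refl (f : ℂ → ℂ) : Lift f f (fun _ => 0) :=
  ⟨continuousOn_const, fun _ _ => le_rfl, tendsto_const_nhds, fun z _ => ⟨1, one_pos, by simp⟩⟩

lemma Lift.trans {f g h : ℂ → ℂ} {θ η : ℂ → ℝ} (h1 : Lift f g θ) (h2 : Lift g h η) :
    Lift f h (fun z => θ z + η z) := by
  obtain ⟨a1, a2, a3, a4⟩ := h1
  obtain ⟨b1, b2, b3, b4⟩ := h2
  refine ⟨a1.add b1, fun z hz => add_nonneg (a2 z hz) (b2 z hz), by simpa using a3.add b3, ?_⟩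
  intro z hz
  obtain ⟨r, hr, e⟩ := a4 z hz
  obtain ⟨q, hq, e'⟩ := b4 z hz
  refine ⟨q * r, mul_pos hq hr, ?_⟩
  rw [e', e]
  push_cast
  rw [add_mul, Complex.exp_add]
  ring

/-- evaluation of `U` -/
def uf (s : Multiset ℝ) (z : ℂ) : ℂ := aeval z (U s)

lemma uf_continuous (s : Multiset ℝ) : Continuous (uf s) := (U s).continuous_aeval

lemma uf_ne (s : Multiset ℝ) (hs : ∀ a ∈ s, 0 ≤ a ∧ a ≤ 1) (hc : 2 ≤ s.card) (z : ℂ) (hz : z ∈ HP) :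
    uf s z ≠ 0 :=
  (key s.card s rfl hs).1 (by omega) z hz

lemma uf_one (s : Multiset ℝ) (hs : ∀ a ∈ s, 0 ≤ a ∧ a ≤ 1) (hc : 2 ≤ s.card) :
    ∃ r : ℝ, 0 < r ∧ uf s 1 = r := by
  have hne : U s ≠ 0 := by
    intro h
    refine uf_ne s hs hc Complex.I (by simp [HP]) ?_
    simp [uf, h]
  refine ⟨(U s).eval 1, eval_pos_of_coeff_nonneg _ hne
    (U_coeff_nonneg s fun a ha => (hs a ha).1) 1 one_pos, ?_⟩
  have := Polynomial.aeval_algebraMap_apply ℂ (1 : ℝ) (U s)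
  simpa [uf] using this

lemma step (a b : ℝ) (s : Multiset ℝ) (ha : 0 ≤ a ∧ a ≤ 1) (hb : 0 ≤ b ∧ b ≤ 1) (hab : b ≤ a)
    (hs : ∀ a ∈ s, 0 ≤ a ∧ a ≤ 1) (hc : 1 ≤ s.card) :
    ∃ θ, Lift (uf (a ::ₘ s)) (uf (b ::ₘ s)) θ := by
  have hsa : ∀ c ∈ a ::ₘ s, 0 ≤ c ∧ c ≤ 1 := by
    intro c hc; rcases Multiset.mem_cons.1 hc with rfl | h; exacts [ha, hs c h]
  have hsb : ∀ c ∈ b ::ₘ s, 0 ≤ c ∧ c ≤ 1 := by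
    intro c hc; rcases Multiset.mem_cons.1 hc with rfl | h; exacts [hb, hs c h]
  have hca : 2 ≤ (a ::ₘ s).card := by rw [Multiset.card_cons]; omega
  have hcb : 2 ≤ (b ::ₘ s).card := by rw [Multiset.card_cons]; omega
  set f := uf (a ::ₘ s) with hf
  set g := uf (b ::ₘ s) with hg
  have fne : ∀ z ∈ HP, f z ≠ 0 := uf_ne _ hsa hca
  have gne : ∀ z ∈ HP, g z ≠ 0 := uf_ne _ hsb hcb
  have hrat : ∀ z ∈ HP, g z / f z = 1 ∨ 0 < (g z / f z).im := by
    intro z hz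
    by_cases hgf : g z = f z
    · left; rw [hgf, div_self (fne z hz)]
    right
    have e1 : f z = aeval z (V s) + a * aeval z (U s) := aeval_U_cons z a s
    have e2 : g z = aeval z (V s) + b * aeval z (U s) := aeval_U_cons z b s
    have hU : aeval z (U s) ≠ 0 := by
      intro h; apply hgf; rw [e1, e2, h]; simp
    have hlt : b < a := by
      refine lt_of_le_of_ne hab ?_
      rintro rfl; exact hgf rfl
    have hw := ((key s.card s rfl hs).2 z hz).2.2 hc hU
    set w := aeval z (V s) / aeval z (U s) with hwdef
    have hwa : w + a ≠ 0 := by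
      intro h; have := congrArg Complex.im h; simp at this; exact hw.ne' this
    have e : g z / f z = 1 - ((a - b : ℝ) : ℂ) * (w + a)⁻¹ := by
      have hV : aeval z (V s) = w * aeval z (U s) := by rw [hwdef]; field_simp
      rw [e1, e2, hV, ← add_mul, ← add_mul, mul_div_mul_right _ _ hU]
      field_simp
      push_cast
      ring
    rw [e, Complex.sub_im, Complex.im_ofReal_mul, Complex.inv_im]
    have h1 : 0 < (w + a).im / Complex.normSq (w + a) :=
      div_pos (by simpa using hw) (Complex.normSq_pos.2 hwa)
    have h2 := mul_pos (sub_pos.2 hlt) h1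
    rw [neg_div, Complex.one_im]
    linarith
  have hcf : Continuous f := uf_continuous _
  have hcg : Continuous g := uf_continuous _
  refine ⟨fun z => Complex.arg (g z / f z), ?_, ?_, ?_, ?_⟩
  · intro z hz
    have h1 : ContinuousAt (fun z => g z / f z) z := hcg.continuousAt.div hcf.continuousAt (fne z hz)
    have h2 : g z / f z ∈ Complex.slitPlane := by
      rcases hrat z hz with h | h
      · rw [h]; exact Complex.one_mem_slitPlane
      · right; exact h.ne'
    exact (ContinuousAt.comp (f := fun z => g z / f z) (Complex.continuousAt_arg h2) h1).continuousWithinAt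
  · intro z hz
    rw [Complex.arg_nonneg_iff]
    rcases hrat z hz with h | h
    · rw [h]; simp
    · exact h.le
  · obtain ⟨r, hr, e1⟩ := uf_one _ hsa hca
    obtain ⟨q, hq, e2⟩ := uf_one _ hsb hcb
    have hf1 : f 1 = r := e1
    have hg1 : g 1 = q := e2
    have h1 : ContinuousAt (fun z => g z / f z) 1 :=
      hcg.continuousAt.div hcf.continuousAt (by rw [hf1]; exact_mod_cast hr.ne')
    have e3 : g 1 / f 1 = ((q / r : ℝ) : ℂ) := by rw [hf1, hg1]; push_cast; rfl
    have hqr : 0 < q / r := div_pos hq hr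
    have h2 : g 1 / f 1 ∈ Complex.slitPlane := by
      rw [e3]; exact Complex.ofReal_mem_slitPlane.2 hqr
    have h3 : ContinuousAt (fun z => Complex.arg (g z / f z)) 1 :=
      ContinuousAt.comp (f := fun z => g z / f z) (Complex.continuousAt_arg h2) h1
    have h4 : Complex.arg (g 1 / f 1) = 0 := by
      rw [e3]; exact Complex.arg_ofReal_of_nonneg hqr.le
    have h5 := h3.tendsto
    rw [h4] at h5
    exact h5.mono_left nhdsWithin_le_nhds
  · intro z hz
    refine ⟨‖g z / f z‖, norm_pos_iff.2 (div_ne_zero (gne z hz) (fne z hz)), ?_⟩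
    rw [Complex.norm_mul_exp_arg_mul_I, div_mul_cancel₀ _ (fne z hz)]

lemma chain (M : Multiset (ℝ × ℝ)) : ∀ s : Multiset ℝ,
    (∀ p ∈ M, (0 ≤ p.1 ∧ p.1 ≤ 1) ∧ (0 ≤ p.2 ∧ p.2 ≤ 1) ∧ p.2 ≤ p.1) →
    (∀ a ∈ s, 0 ≤ a ∧ a ≤ 1) → 2 ≤ M.card + s.card →
    ∃ θ, Lift (uf (M.map Prod.fst + s)) (uf (M.map Prod.snd + s)) θ := by
  induction M using Multiset.induction_on with
  | empty => intro s _ _ _; exact ⟨_, by simpa using Lift.refl (uf s)⟩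
  | cons p M ih =>
    intro s hM hs hc
    have hp := hM p (Multiset.mem_cons_self p M)
    have hM' : ∀ q ∈ M, _ := fun q hq => hM q (Multiset.mem_cons_of_mem hq)
    rw [Multiset.card_cons] at hc
    obtain ⟨θ, h1⟩ := step p.1 p.2 (M.map Prod.fst + s) hp.1 hp.2.1 hp.2.2 (by
      intro a ha
      rcases Multiset.mem_add.1 ha with h | h
      · obtain ⟨q, hq, rfl⟩ := Multiset.mem_map.1 h
        exact (hM' q hq).1
      · exact hs a h) (by rw [Multiset.card_add, Multiset.card_map]; omega)
    obtain ⟨η, h2⟩ := ih (p.2 ::ₘ s) hM' (by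
      intro a ha
      rcases Multiset.mem_cons.1 ha with rfl | h
      · exact hp.2.1
      · exact hs a h) (by rw [Multiset.card_cons]; omega)
    rw [Multiset.add_cons, Multiset.add_cons] at h2
    rw [Multiset.map_cons, Multiset.map_cons, Multiset.cons_add, Multiset.cons_add]
    exact ⟨_, h1.trans h2⟩

lemma HP_preconnected : IsPreconnected HP := (convex_halfSpace_im_gt 0).isPreconnected

lemma total_bound (n : ℕ) (hn : 2 ≤ n) (Θ : ℂ → ℝ)
    (h : Lift (uf (Multiset.replicate n 1)) (uf (Multiset.replicate n 0)) Θ) :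
    ∀ z ∈ HP, Θ z < Real.pi := by
  obtain ⟨m, rfl⟩ : ∃ m, n = m + 1 := ⟨n - 1, by omega⟩
  obtain ⟨h1, h2, h3, h4⟩ := h
  set ι : ℂ → ℂ := fun z => (starRingEnd ℂ z)⁻¹ with hι
  have hne0 : ∀ z ∈ HP, z ≠ 0 := by
    rintro z hz rfl
    simp [HP] at hz
  have hmap : ∀ z ∈ HP, ι z ∈ HP := by
    intro z hz
    have hz' : 0 < z.im := hz
    have hz0 := hne0 z hz
    simp only [hι, HP, Set.mem_ofPred_eq, Complex.inv_im, Complex.conj_im, neg_neg]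
    exact div_pos hz' (Complex.normSq_pos.2 (by simpa using hz0))
  have hιc : ∀ z, z ≠ 0 → ContinuousAt ι z := by
    intro z hz
    exact Complex.continuous_conj.continuousAt.inv₀ (by simpa using hz)
  set ψ : ℂ → ℝ := fun z => Θ z + Θ (ι z) - Complex.arg z with hψ
  have hψc : ContinuousOn ψ HP := by
    refine (h1.add (h1.comp (fun z hz => (hιc z (hne0 z hz)).continuousWithinAt) hmap)).sub ?_
    intro z hz
    exact (Complex.continuousAt_arg (Or.inr (ne_of_gt hz))).continuousWithinAt
  have hψt : Tendsto ψ (𝓝[HP] 1) (𝓝 0) := by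
    have a1 : Tendsto ι (𝓝[HP] 1) (𝓝[HP] 1) := by
      refine tendsto_nhdsWithin_iff.2 ⟨?_, ?_⟩
      · have := (hιc 1 one_ne_zero).tendsto
        simp only [hι, map_one, inv_one] at this
        exact this.mono_left nhdsWithin_le_nhds
      · filter_upwards [self_mem_nhdsWithin] with z hz using hmap z hz
    have a2 : Tendsto Complex.arg (𝓝[HP] 1) (𝓝 0) := by
      have := (Complex.continuousAt_arg Complex.one_mem_slitPlane).tendsto
      rw [Complex.arg_one] at this
      exact this.mono_left nhdsWithin_le_nhds
    simpa using (h3.add (h3.comp a1)).sub a2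
  have hexp : ∀ z ∈ HP, Complex.exp (ψ z * Complex.I) = 1 := by
    intro z hz
    have hz0 := hne0 z hz
    obtain ⟨r, hr, e1⟩ := h4 z hz
    obtain ⟨q, hq, e2⟩ := h4 (ι z) (hmap z hz)
    have e3 := congrArg (starRingEnd ℂ) e2
    simp only [uf, map_mul, ← aeval_conj', U_zeros, Complex.conj_ofReal, ← Complex.exp_conj,
      Complex.conj_I] at e1 e3
    have hcι : starRingEnd ℂ (ι z) = z⁻¹ := by simp [hι]
    rw [hcι] at e3
    have e4 := derangePoly_symm (m + 1) z hz0
    have e5 := AU_symm m z hz0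
    have hA : aeval z (U (Multiset.replicate (m + 1) 1)) ≠ 0 := by
      refine uf_ne _ ?_ (by simpa using hn) z hz
      intro a ha
      rw [Multiset.eq_of_mem_replicate ha]; norm_num
    set A := aeval z (U (Multiset.replicate (m + 1) 1))
    have e6 : (r : ℂ) * Complex.exp (Θ z * Complex.I) * A
        = q * Complex.exp (Θ (ι z) * -Complex.I) * (z * A) := by
      rw [← e1, e4, e3, e5]; ring
    have e7 : (r : ℂ) * Complex.exp (Θ z * Complex.I)
        = q * Complex.exp (Θ (ι z) * -Complex.I) * z := by
      apply mul_right_cancel₀ hA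
      rw [e6]; ring
    have e8 : z = ‖z‖ * Complex.exp (Complex.arg z * Complex.I) :=
      (Complex.norm_mul_exp_arg_mul_I z).symm
    have e9 : (r : ℂ) * Complex.exp (ψ z * Complex.I) = q * ‖z‖ := by
      have b1 : (ψ z : ℂ) * Complex.I = Θ z * Complex.I + (Θ (ι z) * Complex.I
          + -(Complex.arg z * Complex.I)) := by
        simp only [hψ]; push_cast; ring
      rw [b1, Complex.exp_add, ← mul_assoc, e7]
      nth_rw 2 [e8]
      have b2 : Complex.exp (Θ (ι z) * -Complex.I) * Complex.exp (Complex.arg z * Complex.I) *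
          Complex.exp (Θ (ι z) * Complex.I + -(Complex.arg z * Complex.I)) = 1 := by
        rw [← Complex.exp_add, ← Complex.exp_add, ← Complex.exp_zero]
        congr 1; ring
      linear_combination (q : ℂ) * ‖z‖ * b2
    have e10 : r = q * ‖z‖ := by
      have := congrArg norm e9
      rw [norm_mul, norm_mul, Complex.norm_exp_ofReal_mul_I] at this
      simpa [abs_of_pos hr, abs_of_pos hq] using this
    have hr' : (r : ℂ) ≠ 0 := by exact_mod_cast hr.ne'
    apply mul_left_cancel₀ hr'
    rw [e9, e10]; push_cast; ring
  have hcos : ∀ z ∈ HP, Real.cos (ψ z) = 1 := by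
    intro z hz
    have := congrArg Complex.re (hexp z hz)
    rwa [Complex.exp_ofReal_mul_I_re, Complex.one_re] at this
  have hNB : (𝓝[HP] (1 : ℂ)).NeBot := by
    rw [← mem_closure_iff_nhdsWithin_neBot]
    have : closure HP = {z : ℂ | 0 ≤ z.im} := Complex.closure_setOfPred_lt_im 0
    rw [this]; simp
  obtain ⟨z1, hz1, hψ1⟩ : ∃ z1 ∈ HP, |ψ z1| < Real.pi := by
    have : ∀ᶠ z in 𝓝[HP] (1 : ℂ), |ψ z| < Real.pi := by
      have := hψt.abs
      rw [abs_zero] at this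
      exact this.eventually (gt_mem_nhds Real.pi_pos)
    obtain ⟨z, hz⟩ := (this.and self_mem_nhdsWithin).exists
    exact ⟨z, hz.2, hz.1⟩
  have himg := HP_preconnected.image ψ hψc
  have hord := himg.ordConnected
  have hnot : ∀ x, Real.cos x = -1 → x ∉ ψ '' HP := by
    rintro x hx ⟨z, hz, rfl⟩
    rw [hcos z hz] at hx
    norm_num at hx
  intro z hz
  rw [abs_lt] at hψ1
  have hlt : ψ z < Real.pi := by
    by_contra! hge
    exact hnot Real.pi Real.cos_pi
      (hord.out (Set.mem_image_of_mem ψ hz1) (Set.mem_image_of_mem ψ hz) ⟨hψ1.2.le, hge⟩)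
  have hgt : -Real.pi < ψ z := by
    by_contra! hge
    exact hnot (-Real.pi) (by rw [Real.cos_neg, Real.cos_pi])
      (hord.out (Set.mem_image_of_mem ψ hz) (Set.mem_image_of_mem ψ hz1) ⟨hge, hψ1.1.le⟩)
  have hψ0 : ψ z = 0 := by
    refine (Real.cos_eq_one_iff_of_lt_of_lt ?_ ?_).1 (hcos z hz)
    · linarith [Real.pi_pos]
    · linarith [Real.pi_pos]
  have harg : Complex.arg z < Real.pi := by
    rw [Complex.arg_lt_pi_iff]
    right; exact ne_of_gt hz
  have := h2 (ι z) (hmap z hz)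
  simp only [hψ] at hψ0
  linarith

lemma main_lift {n : ℕ} (hn : 2 ≤ n) (a b : Fin n → ℝ) (ha : ∀ k, 0 ≤ a k ∧ a k ≤ 1)
    (hb : ∀ k, 0 ≤ b k ∧ b k ≤ 1) (hab : ∀ k, b k ≤ a k) (z : ℂ) (hz : z ∈ HP) :
    ∃ r θ : ℝ, 0 < r ∧ 0 ≤ θ ∧ θ < Real.pi ∧ uf (Finset.univ.val.map b) z
      = r * Complex.exp (θ * Complex.I) * uf (Finset.univ.val.map a) z := by
  have gen : ∀ a b : Fin n → ℝ, (∀ k, 0 ≤ a k ∧ a k ≤ 1) → (∀ k, 0 ≤ b k ∧ b k ≤ 1) →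
      (∀ k, b k ≤ a k) → ∃ θ, Lift (uf (Finset.univ.val.map a)) (uf (Finset.univ.val.map b)) θ := by
    intro a b ha hb hab
    have := chain (Finset.univ.val.map fun k => (a k, b k)) 0 (by
      intro p hp
      obtain ⟨k, _, rfl⟩ := Multiset.mem_map.1 hp
      exact ⟨ha k, hb k, hab k⟩) (by simp) (by simpa using hn)
    simpa [Multiset.map_map, Function.comp_def] using this
  obtain ⟨θ1, l1⟩ := gen (fun _ => 1) a (fun _ => by norm_num) ha fun k => (ha k).2
  obtain ⟨θ2, l2⟩ := gen a b ha hb hab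
  obtain ⟨θ3, l3⟩ := gen b (fun _ => 0) hb (fun _ => by norm_num) fun k => (hb k).1
  have lt := (l1.trans l2).trans l3
  have c1 : ∀ x : ℝ, (Finset.univ : Finset (Fin n)).val.map (fun _ => x) = Multiset.replicate n x := by
    intro x; simp
  rw [c1, c1] at lt
  have hb := total_bound n hn _ lt z hz
  obtain ⟨r, hr, e⟩ := l2.2.2.2 z hz
  have := l1.2.1 z hz
  have := l3.2.1 z hz
  exact ⟨r, θ2 z, hr, l2.2.1 z hz, by linarith, e⟩

lemma stable_of_natDegree_zero (f : ℂ[X]) (hf : f.natDegree ≤ 0) : StableC f := by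
  rw [eq_C_of_natDegree_le_zero hf]
  by_cases h : f.coeff 0 = 0
  · left; simp [h]
  · right; intro z _; simpa using h

lemma Dmap_prod {n : ℕ} (c : ℝ) (α : Fin n → ℝ) :
    Dmap (C c * ∏ k, (X - C (α k))) = c • U (Finset.univ.val.map fun k => - α k) := by
  rw [Dmap_eq, ← smul_eq_C_mul, map_smul, U, pr, Multiset.map_map]
  congr 2
  simp [Finset.prod, sub_eq_add_neg]

end DP

end

/-- if `p = c·Π_k (x - α_k)` and `q = c'·Π_k (x - β_k)` with
`c, c' > 0`, all `α_k, β_k ∈ [-1,0]`, both tuples weakly increasing, and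
`α_k ≤ β_k` for every `k`, then `D(p) ≺ D(q)`. -/
theorem stmt14 (n : ℕ) (c c' : ℝ) (hc : 0 < c) (hc' : 0 < c')
    (α β : Fin n → ℝ)
    (hα : ∀ k, -1 ≤ α k ∧ α k ≤ 0) (hβ : ∀ k, -1 ≤ β k ∧ β k ≤ 0)
    (hαmono : Monotone α) (hβmono : Monotone β)
    (hle : ∀ k, α k ≤ β k) :
    Interlaces (Dmap (Polynomial.C c * ∏ k, (X - Polynomial.C (α k))))
      (Dmap (Polynomial.C c' * ∏ k, (X - Polynomial.C (β k)))) := by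
  rw [DP.Dmap_prod, DP.Dmap_prod]
  unfold Interlaces
  set a : Fin n → ℝ := fun k => -α k with ha
  set b : Fin n → ℝ := fun k => -β k with hb
  by_cases hn : 2 ≤ n
  · right
    intro z hz
    have ha' : ∀ k, 0 ≤ a k ∧ a k ≤ 1 := fun k => by
      have := hα k; constructor <;> simp only [ha] <;> linarith
    have hb' : ∀ k, 0 ≤ b k ∧ b k ≤ 1 := fun k => by
      have := hβ k; constructor <;> simp only [hb] <;> linarith
    obtain ⟨r, θ, hr, h0, hpi, e⟩ := DP.main_lift hn a b ha' hb'
      (fun k => neg_le_neg (hle k)) z hz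
    have hne := DP.uf_ne (Finset.univ.val.map a) (by
      intro x hx
      obtain ⟨k, _, rfl⟩ := Multiset.mem_map.1 hx
      exact ha' k) (by simpa using hn) z hz
    have ev : (toC (c' • DP.U (Finset.univ.val.map b)) + Polynomial.C Complex.I
        * toC (c • DP.U (Finset.univ.val.map a))).eval z
        = c' * DP.uf (Finset.univ.val.map b) z + Complex.I * (c * DP.uf (Finset.univ.val.map a) z) := by
      simp only [toC, eval_add, eval_mul, eval_C, eval_map_algebraMap, map_smul, Complex.real_smul,
        DP.uf]
    rw [ev, e]
    have e2 : (c' : ℂ) * (r * Complex.exp (θ * Complex.I) * DP.uf (Finset.univ.val.map a) z)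
        + Complex.I * (c * DP.uf (Finset.univ.val.map a) z)
        = (((c' * r : ℝ) : ℂ) * Complex.exp (θ * Complex.I) + (c : ℂ) * Complex.I)
          * DP.uf (Finset.univ.val.map a) z := by
      push_cast; ring
    rw [e2]
    refine mul_ne_zero ?_ hne
    intro h
    have him := congrArg Complex.im h
    rw [Complex.add_im, Complex.im_ofReal_mul, Complex.im_ofReal_mul, Complex.exp_ofReal_mul_I_im,
      Complex.I_im, Complex.zero_im] at him
    have hs := Real.sin_nonneg_of_nonneg_of_le_pi h0 hpi.le
    have := mul_nonneg (mul_pos hc' hr).le hs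
    linarith
  · apply DP.stable_of_natDegree_zero
    have hd : ∀ (x : ℝ) (g : Fin n → ℝ), (toC (x • DP.U (Finset.univ.val.map g))).natDegree ≤ 0 := by
      intro x g
      unfold toC
      refine natDegree_map_le.trans ((natDegree_smul_le _ _).trans ((DP.U_natDegree _).trans ?_))
      simp
      omega
    exact natDegree_add_le_of_degree_le (hd _ _) ((natDegree_C_mul_le _ _).trans (hd _ _))
end
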